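/- arXiv:2207.05417 — 11 statements merged into one kernel-verified Lean document; each statement's English description precedes it below -/
import Mathlib

section
/- Let q be a prime power and let d ≥ 1 be an integer. If there exists a q-ary linear code of length n, dimension k = n − d with k ≥ 2, and minimum distance at least d, then d ≤ 2q. -/
open Finset

section Defs

variable {F : Type*} [Field F] [Fintype F] [DecidableEq F]

/-- The minimum (Hamming) distance of the linear code `C` is exactly `d`. -/
def MinDistIs {n : ℕ} (C : Submodule F (Fin n → F)) (d : ℕ) : Prop :=
  (∃ c ∈ C, c ≠ 0 ∧ hammingNorm c = d) ∧ ∀ c ∈ C, c ≠ 0 → d ≤ hammingNorm c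

/-- `R` is a recovery set at coordinate `i` for the code `C`: any two codewords that agree
on all coordinates of `R` other than `i` also agree at `i`. -/
def IsRecoverySet {n : ℕ} (C : Submodule F (Fin n → F)) (i : Fin n)
    (R : Finset (Fin n)) : Prop :=
  i ∈ R ∧ ∀ u ∈ C, ∀ v ∈ C, (∀ j ∈ R, j ≠ i → u j = v j) → u i = v i

/-- The code `C` has locality `r`: every coordinate has a recovery set of size at most `r+1`. -/
def HasLocality {n : ℕ} (C : Submodule F (Fin n → F)) (r : ℕ) : Prop :=
  ∀ i : Fin n, ∃ R : Finset (Fin n), R.card ≤ r + 1 ∧ IsRecoverySet C i R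

/-- The parameters attain the Singleton-type bound for LRCs: `d = n - k - ⌈k/r⌉ + 2`. -/
def SingletonOptimalParams (n k d r : ℕ) : Prop :=
  (d : ℤ) = (n : ℤ) - (k : ℤ) - ⌈(k : ℚ) / (r : ℚ)⌉ + 2

/-- `C` is a Singleton-optimal `[n,k,d;r]`-locally repairable code over `F`. -/
def IsOptLRC {n : ℕ} (C : Submodule F (Fin n → F)) (k d r : ℕ) : Prop :=
  Module.finrank F ↥C = k ∧ MinDistIs C d ∧ HasLocality C r ∧ SingletonOptimalParams n k d r

/-- `x` belongs to the dual code of `C` (w.r.t. the standard bilinear form). -/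
def InDual {n : ℕ} (C : Submodule F (Fin n → F)) (x : Fin n → F) : Prop :=
  ∀ c ∈ C, ∑ i, x i * c i = 0

/-- `P` is a partition of the coordinates `{1,…,n}` into supports of dual codewords of
Hamming weight at most `r+1` (disjoint recovery sets). -/
def IsRecoveryPartition {n : ℕ} (C : Submodule F (Fin n → F)) (r : ℕ)
    (P : Finset (Finset (Fin n))) : Prop :=
  (∀ S ∈ P, ∃ c : Fin n → F, InDual C c ∧ c ≠ 0 ∧ hammingNorm c ≤ r + 1 ∧
      (Finset.univ.filter fun i => c i ≠ 0) = S) ∧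
  (∀ S ∈ P, ∀ T ∈ P, S ≠ T → Disjoint S T) ∧
  (∀ i : Fin n, ∃ S ∈ P, i ∈ S)

/-- `C` has disjoint recovery sets. -/
def HasDisjointRecoverySets {n : ℕ} (C : Submodule F (Fin n → F)) (r : ℕ) : Prop :=
  ∃ P : Finset (Finset (Fin n)), IsRecoveryPartition C r P

/-- The Main MDS Conjecture over `F`: every nontrivial MDS code over `F`
(dimension `κ` with `2 ≤ κ ≤ m - 2`, minimum distance `δ = m - κ + 1`) has
length `m` at most `q + 2`, where `q = |F|`. -/
def MDSConjecture (F : Type*) [Field F] [Fintype F] [DecidableEq F] : Prop :=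
  ∀ (m κ δ : ℕ) (D : Submodule F (Fin m → F)),
    Module.finrank F ↥D = κ → MinDistIs D δ → δ + κ = m + 1 →
    2 ≤ κ → κ + 2 ≤ m → m ≤ Fintype.card F + 2

end Defs

/-- Lemma 3.4: if there is a `q`-ary linear code of length `n`,
dimension `k = n - d` with `k ≥ 2`, and minimum distance at least `d`, then `d ≤ 2q`. -/
theorem dist_le_two_q {F : Type*} [Field F] [Fintype F] [DecidableEq F]
    {n k d : ℕ} (hd : 1 ≤ d) (hn : n = k + d) (hk : 2 ≤ k)
    (C : Submodule F (Fin n → F))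
    (hdim : Module.finrank F ↥C = k)
    (hmin : ∀ c ∈ C, c ≠ 0 → d ≤ hammingNorm c) :
    d ≤ 2 * Fintype.card F := by
  classical
  obtain ⟨S, -, hS⟩ := Finset.exists_subset_card_eq
    (s := (Finset.univ : Finset (Fin n))) (n := k - 2) (by simp; omega)
  let f : C →ₗ[F] (S → F) :=
    (LinearMap.funLeft F F (fun i : S => (i : Fin n))).comp C.subtype
  have hf : ∀ w ∈ LinearMap.ker f, ∀ i ∈ S, (w : Fin n → F) i = 0 := by
    intro w hw i hi
    have := congrFun (LinearMap.mem_ker.mp hw) ⟨i, hi⟩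
    exact this
  have hrank : 1 < Module.finrank F (LinearMap.ker f) := by
    have h1 := LinearMap.finrank_range_add_finrank_ker f
    have h2 := Submodule.finrank_le (LinearMap.range f)
    rw [Module.finrank_fintype_fun_eq_card, Fintype.card_coe] at h2
    omega
  have : Nontrivial (LinearMap.ker f) := Module.nontrivial_of_finrank_pos (R := F) (by omega)
  obtain ⟨v, hv⟩ := exists_ne (0 : LinearMap.ker f)
  obtain ⟨u, huv⟩ := exists_linearIndependent_pair_of_one_lt_finrank (R := F)
    (M := LinearMap.ker f) hrank hv
  replace huv := (LinearIndependent.pair_iff (R := F) (M := LinearMap.ker f)).mp huv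
  let g : Option F → LinearMap.ker f := fun o => o.elim v (fun a => u + a • v)
  have hg : ∀ o, g o ≠ 0 := by
    intro o h
    cases o with
    | none => exact hv h
    | some a =>
      have h' : u + a • v = 0 := h
      have := huv a 1 (by rw [one_smul, add_comm]; exact h')
      exact one_ne_zero this.2
  let Z : Option F → Finset (Fin n) := fun o => Sᶜ.filter (fun i => ((g o : C) : Fin n → F) i = 0)
  have hZ : ∀ o, (Z o).card ≤ 2 := by
    intro o
    have h1 := hmin ((g o : C) : Fin n → F) (g o : C).2 (by
      intro h; apply hg o; apply Subtype.ext; apply Subtype.ext; exact h)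
    have h2 : Finset.univ.filter (fun i => ((g o : C) : Fin n → F) i ≠ 0) ⊆ Sᶜ \ Z o := by
      intro i hi
      have hi' := (Finset.mem_filter.mp hi).2
      simp only [Z, Finset.mem_sdiff, Finset.mem_filter, Finset.mem_compl]
      exact ⟨fun hs => hi' (hf _ (g o).2 i hs), fun h => hi' h.2⟩
    have h3 := Finset.card_le_card h2
    rw [Finset.card_sdiff_of_subset (Finset.filter_subset _ _), Finset.card_compl,
      Fintype.card_fin] at h3
    unfold hammingNorm at h1
    change _ ≤ n - S.card - (Z o).card at h3
    have h4 := h1.trans h3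
    omega
  have hcov : Sᶜ ⊆ Finset.univ.biUnion Z := by
    intro i hi
    rw [Finset.mem_biUnion]
    by_cases h : ((v : C) : Fin n → F) i = 0
    · exact ⟨none, Finset.mem_univ _, Finset.mem_filter.mpr ⟨hi, h⟩⟩
    · refine ⟨some (-((u : C) : Fin n → F) i / ((v : C) : Fin n → F) i), Finset.mem_univ _,
        Finset.mem_filter.mpr ⟨hi, ?_⟩⟩
      simp [g, h]
  have h1 := Finset.card_le_card hcov
  have h2 := Finset.card_biUnion_le_card_mul Finset.univ Z 2 (fun o _ => hZ o)
  rw [Finset.card_compl, Fintype.card_fin] at h1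
  rw [Finset.card_univ, Fintype.card_option] at h2
  omega
end

section
/- Let C be a q-ary Singleton-optimal [n,k,d;r]-locally repairable code with r ≥ 2, r < k, n ≥ 2(r+1) and d ≥ 3. Then d ≤ 2q. Consequently, if d = λn for some real λ with 0 < λ < 1, then n ≤ 2q/λ. -/
open Finset

/-- Codewords of `C` vanishing on `S`. -/
def subVan {F : Type*} [Field F] {n : ℕ} (C : Submodule F (Fin n → F)) (S : Finset (Fin n)) :
    Submodule F (Fin n → F) where
  carrier := {c | c ∈ C ∧ ∀ i ∈ S, c i = 0}
  add_mem' := by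
    rintro a b ⟨ha, ha'⟩ ⟨hb, hb'⟩
    exact ⟨C.add_mem ha hb, fun i hi => by simp [ha' i hi, hb' i hi]⟩
  zero_mem' := ⟨C.zero_mem, fun i _ => rfl⟩
  smul_mem' := by
    rintro a b ⟨hb, hb'⟩
    exact ⟨C.smul_mem a hb, fun i hi => by simp [hb' i hi]⟩

lemma mem_subVan {F : Type*} [Field F] {n : ℕ} {C : Submodule F (Fin n → F)}
    {S : Finset (Fin n)} {c : Fin n → F} :
    c ∈ subVan C S ↔ c ∈ C ∧ ∀ i ∈ S, c i = 0 := Iff.rfl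

lemma finrank_ker_coord {F : Type*} [Field F] {n : ℕ} (V : Submodule F (Fin n → F)) (j : Fin n) :
    Module.finrank F V ≤
      Module.finrank F (LinearMap.ker ((LinearMap.proj j : (Fin n → F) →ₗ[F] F).domRestrict V)) + 1 := by
  have h := LinearMap.finrank_range_add_finrank_ker
    ((LinearMap.proj j : (Fin n → F) →ₗ[F] F).domRestrict V)
  have h2 := Submodule.finrank_le
    (LinearMap.range ((LinearMap.proj j : (Fin n → F) →ₗ[F] F).domRestrict V))
  rw [Module.finrank_self] at h2
  omega

lemma finrank_subVan_insert {F : Type*} [Field F] {n : ℕ} (C : Submodule F (Fin n → F))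
    (S : Finset (Fin n)) (j : Fin n) :
    Module.finrank F (subVan C S) ≤ Module.finrank F (subVan C (insert j S)) + 1 := by
  refine (finrank_ker_coord (subVan C S) j).trans ?_
  gcongr
  set K := LinearMap.ker ((LinearMap.proj j : (Fin n → F) →ₗ[F] F).domRestrict (subVan C S))
    with hK
  rw [← Submodule.finrank_map_subtype_eq (subVan C S) K]
  refine Submodule.finrank_mono ?_
  rintro _ ⟨c, hc, rfl⟩
  refine ⟨c.2.1, fun i hi => ?_⟩
  rcases Finset.mem_insert.mp hi with rfl | hi
  · exact hc
  · exact c.2.2 i hi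

lemma finrank_subVan_union {F : Type*} [Field F] {n : ℕ} (C : Submodule F (Fin n → F))
    (S T : Finset (Fin n)) :
    Module.finrank F (subVan C S) ≤ Module.finrank F (subVan C (T ∪ S)) + T.card := by
  induction T using Finset.induction_on with
  | empty => rw [Finset.empty_union]; simp
  | insert a T ha ih =>
    rw [Finset.insert_union, Finset.card_insert_of_notMem ha]
    have := finrank_subVan_insert C (T ∪ S) a
    omega

lemma exists_coord {F : Type*} [Field F] {n : ℕ} (C : Submodule F (Fin n → F))
    (S : Finset (Fin n)) (h : 0 < Module.finrank F (subVan C S)) :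
    ∃ i, i ∉ S ∧ ∃ c ∈ subVan C S, c i ≠ 0 := by
  have : subVan C S ≠ ⊥ := by
    intro h0
    rw [h0] at h
    simp at h
  obtain ⟨c, hc, hc0⟩ := Submodule.exists_mem_ne_zero_of_ne_bot this
  obtain ⟨i, hi⟩ := Function.ne_iff.mp hc0
  exact ⟨i, fun hiS => hi (hc.2 i hiS), c, hc, hi⟩

lemma exists_greedy {F : Type*} [Field F] {n r : ℕ} (C : Submodule F (Fin n → F))
    (hloc : HasLocality C r) (m : ℕ) (hm : m * r + 1 ≤ Module.finrank F C) :
    ∃ S : Finset (Fin n), Module.finrank F C + m ≤ Module.finrank F (subVan C S) + S.card ∧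
      Module.finrank F C ≤ Module.finrank F (subVan C S) + m * r := by
  induction m with
  | zero =>
    refine ⟨∅, ?_⟩
    have : subVan C ∅ = C := by ext; simp [mem_subVan]
    rw [this]; simp
  | succ m ih =>
    rw [Nat.succ_mul] at hm ⊢
    obtain ⟨S, h1, h2⟩ := ih (by omega)
    obtain ⟨i, hi, c, hc, hci⟩ := exists_coord C S (by omega)
    obtain ⟨R, hR, hiR, hrec⟩ := hloc i
    set T := (R.erase i) \ S with hT
    have hTc : T.card ≤ r := by
      have := Finset.card_le_card (Finset.sdiff_subset : (R.erase i) \ S ⊆ R.erase i)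
      rw [← hT, Finset.card_erase_of_mem hiR] at this
      omega
    have hiT : i ∉ T ∪ S := by simp [hT, hi]
    have hTS : Disjoint T S := Finset.sdiff_disjoint
    have heq : subVan C (insert i (T ∪ S)) = subVan C (T ∪ S) := by
      ext c
      simp only [mem_subVan, Finset.mem_insert]
      constructor
      · rintro ⟨a, b⟩
        exact ⟨a, fun j hj => b j (Or.inr hj)⟩
      · rintro ⟨a, b⟩
        refine ⟨a, ?_⟩
        rintro j (rfl | hj)
        · refine hrec c a 0 C.zero_mem fun l hl hlj => ?_
          refine b l ?_
          by_cases hlS : l ∈ S <;> simp [hT, hl, hlj, hlS]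
        · exact b j hj
    refine ⟨insert i (T ∪ S), ?_⟩
    have := finrank_subVan_union C S T
    rw [heq, Finset.card_insert_of_notMem hiT, Finset.card_union_of_disjoint hTS]
    omega

lemma exists_ext {F : Type*} [Field F] {n : ℕ} (C : Submodule F (Fin n → F)) (N : ℕ) :
    ∀ (a : ℕ) (S : Finset (Fin n)), n ≤ S.card + a → 2 ≤ Module.finrank F (subVan C S) →
      N ≤ Module.finrank F (subVan C S) + S.card →
    ∃ S : Finset (Fin n), 2 = Module.finrank F (subVan C S) ∧ N ≤ 2 + S.card := by
  intro a
  induction a with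
  | zero =>
    intro S h1 h2 h3
    obtain ⟨i, hi, -⟩ := exists_coord C S (by omega)
    have := Finset.card_lt_univ_of_notMem hi
    simp at this
    omega
  | succ a ih =>
    intro S h1 h2 h3
    rcases h2.eq_or_lt with h | h
    · exact ⟨S, h, by omega⟩
    obtain ⟨i, hi, -⟩ := exists_coord C S (by omega)
    have := finrank_subVan_insert C S i
    have hc := Finset.card_insert_of_notMem hi
    exact ih (insert i S) (by omega) (by omega) (by omega)

lemma plotkin_two {F : Type*} [Field F] [Fintype F] [DecidableEq F] {n d m : ℕ}
    (D : Submodule F (Fin n → F)) (S : Finset (Fin n)) (hD : 2 = Module.finrank F D)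
    (hS : ∀ c ∈ D, ∀ i ∈ S, c i = 0) (hcard : n ≤ S.card + m)
    (hd : ∀ c ∈ D, c ≠ 0 → d ≤ hammingNorm c) :
    (Fintype.card F + 1) * d ≤ Fintype.card F * m := by
  classical
  set q := Fintype.card F with hq
  have hq2 : 2 ≤ q := Fintype.one_lt_card
  have hDcard : Fintype.card D = q ^ 2 := by
    rw [Module.card_eq_pow_finrank (K := F), ← hD]
  have key : ∑ c : D, hammingNorm (c : Fin n → F)
      = ∑ i : Fin n, (Finset.univ.filter fun c : D => (c : Fin n → F) i ≠ 0).card := by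
    simp only [hammingNorm, Finset.card_filter]
    rw [Finset.sum_comm]
  have low : (q ^ 2 - 1) * d ≤ ∑ c : D, hammingNorm (c : Fin n → F) := by
    calc (q ^ 2 - 1) * d = ∑ c ∈ Finset.univ.erase (0 : D), d := by
          rw [Finset.sum_const, Finset.card_erase_of_mem (Finset.mem_univ _), Finset.card_univ,
            hDcard, smul_eq_mul]
      _ ≤ ∑ c ∈ Finset.univ.erase (0 : D), hammingNorm (c : Fin n → F) := by
          refine Finset.sum_le_sum fun c hc => hd c c.2 ?_
          have := Finset.ne_of_mem_erase hc
          simpa using this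
      _ ≤ _ := Finset.sum_le_sum_of_subset (Finset.erase_subset _ _)
  have coord : ∀ i : Fin n,
      (Finset.univ.filter fun c : D => (c : Fin n → F) i ≠ 0).card ≤ q ^ 2 - q := by
    intro i
    set φ := (LinearMap.proj i : (Fin n → F) →ₗ[F] F).domRestrict D with hφ
    have h1 := finrank_ker_coord D i
    rw [← hφ, ← hD] at h1
    have h2 : q ≤ Fintype.card (LinearMap.ker φ) := by
      rw [Module.card_eq_pow_finrank (K := F)]
      calc q = q ^ 1 := (pow_one q).symm
        _ ≤ _ := Nat.pow_le_pow_right (by omega) (by omega)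
    have h3 : Fintype.card (LinearMap.ker φ)
        = (Finset.univ.filter fun c : D => (c : Fin n → F) i = 0).card := by
      rw [← Fintype.card_subtype]
      exact Fintype.card_congr (Equiv.refl _)
    have h4 := Finset.card_filter_add_card_filter_not (s := (Finset.univ : Finset D))
      (fun c : D => (c : Fin n → F) i = 0)
    rw [Finset.card_univ, hDcard] at h4
    have h5 : (Finset.univ.filter fun c : D => (c : Fin n → F) i ≠ 0).card =
      (Finset.univ.filter fun c : D => ¬ (c : Fin n → F) i = 0).card := rfl
    omega
  have up : ∑ i : Fin n, (Finset.univ.filter fun c : D => (c : Fin n → F) i ≠ 0).card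
      ≤ m * (q ^ 2 - q) := by
    rw [← Finset.sum_compl_add_sum S]
    have h0 : ∑ i ∈ S, (Finset.univ.filter fun c : D => (c : Fin n → F) i ≠ 0).card = 0 := by
      refine Finset.sum_eq_zero fun i hi => ?_
      rw [Finset.card_eq_zero, Finset.filter_eq_empty_iff]
      intro c _ h
      exact h (hS c c.2 i hi)
    rw [h0, add_zero]
    refine (Finset.sum_le_card_nsmul _ _ _ fun i _ => coord i).trans ?_
    rw [smul_eq_mul, Finset.card_compl, Fintype.card_fin]
    gcongr
    omega
  have fin := low.trans (key.le.trans up)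
  obtain ⟨p, hp⟩ : ∃ p, q = p + 1 := ⟨q - 1, by omega⟩
  have e1 : q ^ 2 - 1 = p * (q + 1) := by
    rw [hp]; ring_nf; omega
  have e2 : q ^ 2 - q = p * q := by
    rw [hp]; ring_nf; omega
  rw [e1, e2] at fin
  have : p * ((q + 1) * d) ≤ p * (q * m) := by nlinarith
  exact Nat.le_of_mul_le_mul_left this (by omega)

/-- Theorem 3.5: for a Singleton-optimal `[n,k,d;r]`-LRC with
`r ≥ 2`, `r < k`, `n ≥ 2(r+1)` and `d ≥ 3`, one has `d ≤ 2q`; consequently, if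
`d = λn` with `0 < λ < 1`, then `n ≤ 2q/λ`. -/
theorem optLRC_dist_le_two_q {F : Type*} [Field F] [Fintype F] [DecidableEq F]
    {n k d r : ℕ} (C : Submodule F (Fin n → F))
    (hC : IsOptLRC C k d r) (hr : 2 ≤ r) (hrk : r < k)
    (hn : 2 * (r + 1) ≤ n) (hd : 3 ≤ d) :
    d ≤ 2 * Fintype.card F ∧
    ∀ lam : ℝ, 0 < lam → lam < 1 → (d : ℝ) = lam * (n : ℝ) →
      (n : ℝ) ≤ 2 * (Fintype.card F : ℝ) / lam := by
  obtain ⟨hk, ⟨-, hmin⟩, hloc, hopt⟩ := hC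
  have main : d ≤ 2 * Fintype.card F := by
    unfold SingletonOptimalParams at hopt
    have hr0 : (0 : ℚ) < r := by exact_mod_cast (by omega : 0 < r)
    set t := ⌈(k : ℚ) / (r : ℚ)⌉ with ht
    have ht1 : (1 : ℤ) < t := by
      rw [ht, Int.lt_ceil, lt_div_iff₀ hr0]
      push_cast
      rw [one_mul]
      exact_mod_cast hrk
    obtain ⟨m, hm⟩ : ∃ m : ℕ, t = m + 2 := ⟨(t - 2).toNat, by omega⟩
    have hlt : (m + 1) * r < k := by
      have h : ((m : ℤ) + 1) < t := by omega
      rw [ht, Int.lt_ceil, lt_div_iff₀ hr0] at h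
      exact_mod_cast h
    rw [Nat.succ_mul] at hlt
    obtain ⟨S, h1, h2⟩ := exists_greedy C hloc m (by omega)
    obtain ⟨S', h3, h4⟩ := exists_ext C (k + m) n S (by omega) (by omega) (by omega)
    have h5 := plotkin_two (d := d) (m := d + 2) (subVan C S') S' h3
      (fun c hc => hc.2) (by omega) (fun c hc => hmin c hc.1)
    nlinarith
  refine ⟨main, fun lam h0 _ hl => ?_⟩
  rw [le_div_iff₀ h0, mul_comm, ← hl]
  exact_mod_cast main
end

section
/- Let C be a q-ary Singleton-optimal [n,k,d;r]-locally repairable code with r ≥ 2, r < k, n ≥ 2(r+1) and d ≥ 3. Then there exists a q-ary MDS code of some length n' with n' ≥ n − (⌈k/r⌉ − 1)(r+1), dimension n' − (d−1), and minimum distance exactly d. Moreover, if k ≢ 1 (mod r), this MDS code is nontrivial, i.e., its dimension k' satisfies 2 ≤ k' ≤ n' − 2. -/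
open Finset

/-- Vectors vanishing on `S`. -/
def vanishOn (F : Type*) [Field F] {n : ℕ} (S : Finset (Fin n)) : Submodule F (Fin n → F) where
  carrier := {c | ∀ i ∈ S, c i = 0}
  add_mem' := by
    intro a b ha hb i hi
    simp [ha i hi, hb i hi]
  zero_mem' := by
    intro i _
    rfl
  smul_mem' := by
    intro a b hb i hi
    simp [hb i hi]

theorem mem_vanishOn {F : Type*} [Field F] {n : ℕ} {S : Finset (Fin n)} {c : Fin n → F} :
    c ∈ vanishOn F S ↔ ∀ i ∈ S, c i = 0 := Iff.rfl

theorem finrank_inf_ker_coord {F : Type*} [Field F] {n : ℕ} (V : Submodule F (Fin n → F))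
    (i : Fin n) (W : Submodule F (Fin n → F)) (hW : ∀ c ∈ V, c i = 0 → c ∈ W) :
    Module.finrank F V ≤ Module.finrank F W + 1 := by
  let f : V →ₗ[F] F := (LinearMap.proj i).comp V.subtype
  have h1 := f.finrank_range_add_finrank_ker
  have h2 : Module.finrank F (LinearMap.range f) ≤ 1 := by
    have := Submodule.finrank_le (LinearMap.range f)
    simpa using this
  have h3 : Module.finrank F (LinearMap.ker f) ≤ Module.finrank F W := by
    let g : LinearMap.ker f →ₗ[F] W :=
      LinearMap.codRestrict W (V.subtype.comp (LinearMap.ker f).subtype) (by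
        intro c
        exact hW _ c.1.2 c.2)
    apply LinearMap.finrank_le_finrank_of_injective (f := g)
    intro a b hab
    have := congrArg Subtype.val hab
    exact Subtype.ext (Subtype.ext this)
  omega

theorem finrank_inf_vanish_union {F : Type*} [Field F] {n : ℕ} (C : Submodule F (Fin n → F))
    (S T : Finset (Fin n)) :
    Module.finrank F ↥(C ⊓ vanishOn F S) ≤
      Module.finrank F ↥(C ⊓ vanishOn F (S ∪ T)) + T.card := by
  induction T using Finset.induction_on with
  | empty => rw [Finset.union_empty]; simp
  | insert a T ha ih =>
    have := finrank_inf_ker_coord (C ⊓ vanishOn F (S ∪ T)) a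
      (C ⊓ vanishOn F (S ∪ insert a T)) (by
        rintro c ⟨h1, h2⟩ h3
        refine ⟨h1, ?_⟩
        intro i hi
        simp only [Finset.mem_union, Finset.mem_insert] at hi
        rcases hi with hi | rfl | hi
        · exact h2 i (by simp [hi])
        · exact h3
        · exact h2 i (by simp [hi]))
    rw [Finset.card_insert_of_notMem ha]
    omega

theorem exists_ne_zero_of_finrank_pos {F : Type*} [Field F] {n : ℕ}
    (D : Submodule F (Fin n → F)) (h : 0 < Module.finrank F D) : ∃ c ∈ D, c ≠ 0 := by
  apply Submodule.exists_mem_ne_zero_of_ne_bot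
  rintro rfl
  simp at h

theorem singleton_word {F : Type*} [Field F] [DecidableEq F] {N : ℕ}
    (D : Submodule F (Fin N → F)) (h : 0 < Module.finrank F D) :
    ∃ c ∈ D, c ≠ 0 ∧ hammingNorm c + Module.finrank F D ≤ N + 1 := by
  have hle : Module.finrank F D ≤ N := by
    simpa using Submodule.finrank_le D
  obtain ⟨T, -, hT⟩ := Finset.exists_subset_card_eq
    (s := (Finset.univ : Finset (Fin N))) (n := Module.finrank F D - 1) (by simp; omega)
  have h1 := finrank_inf_vanish_union D ∅ T
  have h0 : D ⊓ vanishOn F (∅ : Finset (Fin N)) = D := by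
    ext c
    simp [mem_vanishOn]
  rw [h0] at h1
  obtain ⟨c, ⟨hc1, hc2⟩, hc0⟩ := exists_ne_zero_of_finrank_pos
    (D ⊓ vanishOn F (∅ ∪ T)) (by omega)
  refine ⟨c, hc1, hc0, ?_⟩
  have h2 : hammingNorm c ≤ Tᶜ.card := by
    apply Finset.card_le_card
    intro i hi
    simp only [Finset.mem_filter, Finset.mem_univ, true_and] at hi
    simp only [Finset.mem_compl]
    intro hiT
    exact hi (hc2 i (by simp [hiT]))
  rw [Finset.card_compl, Fintype.card_fin] at h2
  omega

theorem greedy_set {F : Type*} [Field F] [Fintype F] [DecidableEq F] {n r : ℕ}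
    (C : Submodule F (Fin n → F)) (hloc : HasLocality C r) (t : ℕ)
    (ht : (t - 1) * r < Module.finrank F C) :
    ∃ S : Finset (Fin n), S.card ≤ t * (r + 1) ∧
      Module.finrank F C + t ≤ Module.finrank F ↥(C ⊓ vanishOn F S) + S.card := by
  induction t with
  | zero =>
    refine ⟨∅, by simp, ?_⟩
    have h0 : C ⊓ vanishOn F (∅ : Finset (Fin n)) = C := by
      ext c
      simp [mem_vanishOn]
    rw [h0]
    simp
  | succ t ih =>
    simp only [Nat.add_sub_cancel] at ht
    obtain ⟨S, hS1, hS2⟩ := ih (lt_of_le_of_lt (Nat.mul_le_mul_right r (Nat.sub_le t 1)) ht)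
    obtain ⟨c, ⟨hc1, hc2⟩, hc0⟩ := exists_ne_zero_of_finrank_pos (C ⊓ vanishOn F S) (by
      have : t * (r + 1) = t * r + t := by ring
      omega)
    obtain ⟨i, hi⟩ := Function.ne_iff.mp hc0
    have hiS : i ∉ S := fun h => hi (hc2 i h)
    obtain ⟨R, hRc, hiR, hR⟩ := hloc i
    have hdj : i ∉ R.erase i \ S := by simp
    refine ⟨insert i (S ∪ (R.erase i \ S)), ?_, ?_⟩
    · have h1 : insert i (S ∪ (R.erase i \ S)) ⊆ S ∪ R := by
        intro j hj
        simp only [Finset.mem_insert, Finset.mem_union, Finset.mem_sdiff, Finset.mem_erase] at hj ⊢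
        rcases hj with rfl | h | h
        · exact Or.inr hiR
        · exact Or.inl h
        · exact Or.inr h.1.2
      have h2 := Finset.card_le_card h1
      have h3 := Finset.card_union_le S R
      have : (t + 1) * (r + 1) = t * (r + 1) + (r + 1) := by ring
      omega
    · have h1 := finrank_inf_vanish_union C S (R.erase i \ S)
      have h2 : (insert i (S ∪ (R.erase i \ S))).card = S.card + (R.erase i \ S).card + 1 := by
        rw [Finset.card_insert_of_notMem (by simp [hiS]),
          Finset.card_union_of_disjoint Finset.disjoint_sdiff]
      have h3 : C ⊓ vanishOn F (S ∪ (R.erase i \ S)) ≤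
          C ⊓ vanishOn F (insert i (S ∪ (R.erase i \ S))) := by
        rintro u ⟨hu1, hu2⟩
        refine ⟨hu1, ?_⟩
        intro j hj
        rcases Finset.mem_insert.mp hj with rfl | hj
        · have := hR u hu1 0 C.zero_mem (by
            intro l hl hlj
            exact hu2 l (by simp [hl, hlj]))
          simpa using this
        · exact hu2 j hj
      have h4 := Submodule.finrank_mono h3
      omega

theorem puncture {F : Type*} [Field F] [DecidableEq F] {n : ℕ}
    (D : Submodule F (Fin n → F)) (S : Finset (Fin n)) (hD : D ≤ vanishOn F S) :
    ∃ D' : Submodule F (Fin (n - S.card) → F),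
      Module.finrank F D' = Module.finrank F D ∧
      ∀ c' ∈ D', c' ≠ 0 → ∃ c ∈ D, c ≠ 0 ∧ hammingNorm c' = hammingNorm c := by
  have hcard : Sᶜ.card = n - S.card := by rw [Finset.card_compl, Fintype.card_fin]
  let e : Fin (n - S.card) ↪o Fin n := Sᶜ.orderEmbOfFin hcard
  have he : ∀ i, i ∉ S → ∃ j, e j = i := by
    intro i hi
    have : i ∈ Set.range e := by
      rw [Finset.range_orderEmbOfFin]
      simpa using hi
    exact this
  let f : (Fin n → F) →ₗ[F] (Fin (n - S.card) → F) := LinearMap.funLeft F F e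
  have hf : ∀ c j, f c j = c (e j) := fun c j => rfl
  have hinj : ∀ c ∈ D, f c = 0 → c = 0 := by
    intro c hc h
    funext i
    by_cases hi : i ∈ S
    · exact hD hc i hi
    · obtain ⟨j, rfl⟩ := he i hi
      have := congrFun h j
      rw [hf] at this
      exact this
  refine ⟨D.map f, ?_, ?_⟩
  · have hi : Function.Injective (f.domRestrict D) := by
      rw [injective_iff_map_eq_zero]
      intro a ha
      exact Subtype.ext (hinj a.1 a.2 ha)
    have h1 := LinearMap.finrank_range_of_inj hi
    rw [LinearMap.range_domRestrict] at h1
    exact h1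
  · rintro _ ⟨c, hc, rfl⟩ h0
    refine ⟨c, hc, ?_, ?_⟩
    · rintro rfl
      simp at h0
    · unfold hammingNorm
      rw [← Finset.card_map e.toEmbedding]
      congr 1
      ext i
      simp only [Finset.mem_map, Finset.mem_filter, Finset.mem_univ, true_and]
      constructor
      · rintro ⟨j, hj, rfl⟩
        exact hj
      · intro hi
        obtain ⟨j, rfl⟩ := he i (fun h => hi (hD hc i h))
        exact ⟨j, hi, rfl⟩

/-- Lemma 3.6: from a Singleton-optimal `[n,k,d;r]`-LRC with `r ≥ 2`,
`r < k`, `n ≥ 2(r+1)`, `d ≥ 3` one obtains a `q`-ary MDS code of some length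
`n' ≥ n - (⌈k/r⌉ - 1)(r+1)`, dimension `k' = n' - (d-1)` and minimum distance exactly `d`;
moreover if `k ≢ 1 (mod r)` this MDS code is nontrivial, i.e. `2 ≤ k' ≤ n' - 2`. -/
theorem optLRC_gives_MDS {F : Type*} [Field F] [Fintype F] [DecidableEq F]
    {n k d r : ℕ} (C : Submodule F (Fin n → F))
    (hC : IsOptLRC C k d r) (hr : 2 ≤ r) (hrk : r < k)
    (hn : 2 * (r + 1) ≤ n) (hd : 3 ≤ d) :
    ∃ (n' k' : ℕ) (C' : Submodule F (Fin n' → F)),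
      (n : ℤ) - (⌈(k : ℚ) / (r : ℚ)⌉ - 1) * ((r : ℤ) + 1) ≤ (n' : ℤ) ∧
      k' + (d - 1) = n' ∧
      Module.finrank F ↥C' = k' ∧
      MinDistIs C' d ∧
      (¬ k ≡ 1 [MOD r] → 2 ≤ k' ∧ k' + 2 ≤ n') := by
  obtain ⟨hk, ⟨-, hmin⟩, hloc, hopt⟩ := hC
  unfold SingletonOptimalParams at hopt
  have hr0 : (0 : ℚ) < r := by
    have : 0 < r := by omega
    exact_mod_cast this
  obtain ⟨m, hm⟩ : ∃ m : ℕ, ⌈(k : ℚ) / (r : ℚ)⌉ = (m : ℤ) + 1 := by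
    have : 0 < ⌈(k : ℚ) / (r : ℚ)⌉ := by
      apply Int.ceil_pos.mpr
      have : (0 : ℚ) < k := by
        have : 0 < k := by omega
        exact_mod_cast this
      positivity
    refine ⟨(⌈(k : ℚ) / (r : ℚ)⌉ - 1).toNat, ?_⟩
    omega
  rw [hm] at hopt ⊢
  have hmk : m * r < k := by
    have h1 : (m : ℚ) < (k : ℚ) / r := by
      have : (m : ℤ) < ⌈(k : ℚ) / (r : ℚ)⌉ := by omega
      exact_mod_cast Int.lt_ceil.mp this
    rw [lt_div_iff₀ hr0] at h1
    exact_mod_cast h1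
  obtain ⟨S, hS1, hS2⟩ := greedy_set C hloc m (by
    rw [hk]
    exact lt_of_le_of_lt (Nat.mul_le_mul_right r (Nat.sub_le m 1)) hmk)
  rw [hk] at hS2
  have hSn : S.card ≤ n := by simpa using Finset.card_le_univ S
  obtain ⟨D', hD1, hD2⟩ := puncture (C ⊓ vanishOn F S) S inf_le_right
  have hmr : m * (r + 1) = m * r + m := by ring
  obtain ⟨c, hc, hc0, hcw⟩ := singleton_word D' (by omega)
  have hge : ∀ c ∈ D', c ≠ 0 → d ≤ hammingNorm c := by
    intro c hc hc0
    obtain ⟨c1, h1, h2, h3⟩ := hD2 c hc hc0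
    rw [h3]
    exact hmin c1 h1.1 h2
  have hw := hge c hc hc0
  refine ⟨n - S.card, Module.finrank F D', D', ?_, by omega, rfl,
    ⟨⟨c, hc, hc0, by omega⟩, hge⟩, ?_⟩
  · have : ((m : ℤ) + 1 - 1) * ((r : ℤ) + 1) = ((m * (r + 1) : ℕ) : ℤ) := by
      push_cast
      ring
    rw [this]
    omega
  · intro hmod
    have hne : k ≠ 1 + m * r := by
      intro h
      apply hmod
      rw [h]
      simp [Nat.ModEq]
    omega
end

section
/- Assume that every nontrivial MDS code over F_q has length at most q+2 (the Main MDS Conjecture). Let C be a q-ary Singleton-optimal [n,k,d;r]-locally repairable code with r ≥ 2, r < k, n ≥ 2(r+1), d ≥ 3, and k ≢ 1 (mod r). Then n ≤ q + 1 + k + k/r. -/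
open Finset

/-- Codewords of `D` vanishing on `S`. -/
def ZZ {F : Type*} [Field F] {n : ℕ} (D : Submodule F (Fin n → F)) (S : Finset (Fin n)) :
    Submodule F (Fin n → F) where
  carrier := {c | c ∈ D ∧ ∀ i ∈ S, c i = 0}
  zero_mem' := ⟨D.zero_mem, fun _ _ => rfl⟩
  add_mem' := by
    rintro a b ⟨ha, ha'⟩ ⟨hb, hb'⟩
    exact ⟨D.add_mem ha hb, fun i hi => by simp [ha' i hi, hb' i hi]⟩
  smul_mem' := by
    rintro c a ⟨ha, ha'⟩
    exact ⟨D.smul_mem c ha, fun i hi => by simp [ha' i hi]⟩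

theorem mem_ZZ {F : Type*} [Field F] {n : ℕ} (D : Submodule F (Fin n → F)) (S : Finset (Fin n))
    (c : Fin n → F) : c ∈ ZZ D S ↔ c ∈ D ∧ ∀ i ∈ S, c i = 0 := Iff.rfl

theorem ZZ_empty {F : Type*} [Field F] {n : ℕ} (D : Submodule F (Fin n → F)) :
    ZZ D ∅ = D := by
  ext c; simp [mem_ZZ]

theorem ZZ_insert {F : Type*} [Field F] {n : ℕ} (D : Submodule F (Fin n → F))
    (S : Finset (Fin n)) (i : Fin n) :
    Module.finrank F (ZZ D S) ≤ Module.finrank F (ZZ D (insert i S)) + 1 := by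
  have h : ZZ D (insert i S) = ZZ D S ⊓ LinearMap.ker (LinearMap.proj (R := F) (φ := fun _ : Fin n => F) i) := by
    ext c
    simp only [mem_ZZ, Submodule.mem_inf, LinearMap.mem_ker, LinearMap.proj_apply,
      Finset.mem_insert, forall_eq_or_imp]
    tauto
  have h1 := Submodule.finrank_sup_add_finrank_inf_eq (ZZ D S)
    (LinearMap.ker (LinearMap.proj (R := F) (φ := fun _ : Fin n => F) i))
  have h2 := LinearMap.finrank_range_add_finrank_ker
    (LinearMap.proj (R := F) (φ := fun _ : Fin n => F) i)
  have h3 := Submodule.finrank_le (LinearMap.range (LinearMap.proj (R := F) (φ := fun _ : Fin n => F) i))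
  have h4 := Submodule.finrank_le (ZZ D S ⊔
    (LinearMap.ker (LinearMap.proj (R := F) (φ := fun _ : Fin n => F) i)))
  rw [Module.finrank_self] at h3
  rw [h]
  omega

theorem ZZ_union {F : Type*} [Field F] {n : ℕ} (D : Submodule F (Fin n → F))
    (S T : Finset (Fin n)) :
    Module.finrank F (ZZ D S) ≤ Module.finrank F (ZZ D (T ∪ S)) + T.card ∧
    S.card + Module.finrank F (ZZ D S) ≤ (T ∪ S).card + Module.finrank F (ZZ D (T ∪ S)) := by
  induction T using Finset.induction_on with
  | empty => rw [Finset.empty_union]; simp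
  | insert a T ha ih =>
    rw [Finset.insert_union, Finset.card_insert_of_notMem ha]
    have h := ZZ_insert D (T ∪ S) a
    by_cases hm : a ∈ T ∪ S
    · rw [Finset.insert_eq_of_mem hm]; omega
    · rw [Finset.card_insert_of_notMem hm]; omega

theorem greedy {F : Type*} [Field F] [Fintype F] [DecidableEq F] {n k r : ℕ}
    (C : Submodule F (Fin n → F)) (hk : Module.finrank F C = k) (hl : HasLocality C r)
    (j : ℕ) (hj : r * j < k) : ∃ S : Finset (Fin n),
      k ≤ Module.finrank F (ZZ C S) + r * j ∧ k + j ≤ S.card + Module.finrank F (ZZ C S) := by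
  induction j with
  | zero => exact ⟨∅, by rw [ZZ_empty]; simp [hk]⟩
  | succ j ih =>
    rw [Nat.mul_succ] at hj ⊢
    obtain ⟨S, h1, h2⟩ := ih (by omega)
    have hne : ZZ C S ≠ ⊥ := by
      intro h
      rw [h, finrank_bot] at h1
      omega
    obtain ⟨c, hc, hc0⟩ := Submodule.exists_mem_ne_zero_of_ne_bot hne
    obtain ⟨i, hi⟩ := Function.ne_iff.1 hc0
    obtain ⟨R, hR, hiR, hrec⟩ := hl i
    have hiS : i ∉ S := fun h => hi (hc.2 i h)
    obtain ⟨u1, u2⟩ := ZZ_union C S (R.erase i)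
    have hni : i ∉ R.erase i ∪ S := by simp [hiS]
    have heq : ZZ C (insert i (R.erase i ∪ S)) = ZZ C (R.erase i ∪ S) := by
      ext x
      simp only [mem_ZZ, Finset.mem_insert, forall_eq_or_imp]
      refine ⟨fun h => ⟨h.1, h.2.2⟩, fun h => ⟨h.1, ?_, h.2⟩⟩
      refine hrec x h.1 0 C.zero_mem fun j hj hji => ?_
      exact h.2 j (by simp [hj, hji])
    have hcard := Finset.card_erase_of_mem hiR
    refine ⟨insert i (R.erase i ∪ S), ?_, ?_⟩
    · rw [heq]; omega
    · rw [heq, Finset.card_insert_of_notMem hni]; omega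

theorem singleton_bd {F : Type*} [Field F] [Fintype F] [DecidableEq F] {m κ δ : ℕ}
    (D : Submodule F (Fin m → F)) (hk : Module.finrank F D = κ) (hκ : 1 ≤ κ)
    (hδ : ∀ c ∈ D, c ≠ 0 → δ ≤ hammingNorm c) : δ + κ ≤ m + 1 := by
  have hm : κ ≤ m := by
    have := Submodule.finrank_le D
    simp at this; omega
  obtain ⟨T, -, hT⟩ := Finset.exists_subset_card_eq (s := (Finset.univ : Finset (Fin m)))
    (n := κ - 1) (by simp; omega)
  have h := (ZZ_union D ∅ T).1
  rw [ZZ_empty, Finset.union_empty, hk, hT] at h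
  have hne : ZZ D T ≠ ⊥ := by
    intro h'
    rw [h', finrank_bot] at h
    omega
  obtain ⟨c, hc, hc0⟩ := Submodule.exists_mem_ne_zero_of_ne_bot hne
  have h1 := hδ c hc.1 hc0
  have h2 : hammingNorm c ≤ (Tᶜ).card := by
    unfold hammingNorm
    refine Finset.card_le_card fun i hi => ?_
    simp only [Finset.mem_filter, Finset.mem_univ, true_and] at hi
    simp only [Finset.mem_compl]
    exact fun h => hi (hc.2 i h)
  rw [Finset.card_compl, Fintype.card_fin] at h2
  omega

theorem shorten {F : Type*} [Field F] [Fintype F] [DecidableEq F] {n d : ℕ}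
    (C : Submodule F (Fin n → F)) (S : Finset (Fin n))
    (hd : ∀ c ∈ C, c ≠ 0 → d ≤ hammingNorm c) :
    ∃ D : Submodule F (Fin (n - S.card) → F), Module.finrank F D = Module.finrank F (ZZ C S) ∧
      ∀ c ∈ D, c ≠ 0 → d ≤ hammingNorm c := by
  have hcard : (Sᶜ).card = n - S.card := by rw [Finset.card_compl, Fintype.card_fin]
  let e := (Sᶜ).orderEmbOfFin hcard
  let f : (Fin n → F) →ₗ[F] (Fin (n - S.card) → F) := LinearMap.funLeft F F e
  have hf : ∀ c j, f c j = c (e j) := fun _ _ => rfl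
  have hsurj : ∀ i, i ∉ S → ∃ j, e j = i := by
    intro i hi
    have : i ∈ Set.range e := by
      rw [Finset.range_orderEmbOfFin]; simpa using hi
    exact this
  refine ⟨(ZZ C S).map f, ?_, ?_⟩
  · have hinj : Function.Injective (f.domRestrict (ZZ C S)) := by
      rw [← LinearMap.ker_eq_bot, LinearMap.ker_eq_bot']
      rintro ⟨c, hc⟩ h
      ext i
      by_cases hi : i ∈ S
      · exact hc.2 i hi
      · obtain ⟨j, rfl⟩ := hsurj i hi
        exact congrFun h j
    rw [← LinearMap.range_domRestrict]
    exact LinearMap.finrank_range_of_inj hinj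
  · rintro _ ⟨c, hc, rfl⟩ hne
    have hc0 : c ≠ 0 := by rintro rfl; simp at hne
    refine (hd c hc.1 hc0).trans ?_
    unfold hammingNorm
    rw [← Finset.card_map e.toEmbedding]
    refine Finset.card_le_card fun i hi => ?_
    simp only [Finset.mem_filter, Finset.mem_univ, true_and] at hi
    obtain ⟨j, rfl⟩ := hsurj i (fun h => hi (hc.2 i h))
    simp only [Finset.mem_map, Finset.mem_filter, Finset.mem_univ, true_and]
    exact ⟨j, hi, rfl⟩


/-- Theorem 3.7: assuming the Main MDS Conjecture, a `q`-ary
Singleton-optimal `[n,k,d;r]`-LRC with `r ≥ 2`, `r < k`, `n ≥ 2(r+1)`, `d ≥ 3` and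
`k ≢ 1 (mod r)` satisfies `n ≤ q + 1 + k + k/r`. -/
theorem optLRC_length_le_q_plus {F : Type*} [Field F] [Fintype F] [DecidableEq F]
    (hmds : MDSConjecture F)
    {n k d r : ℕ} (C : Submodule F (Fin n → F))
    (hC : IsOptLRC C k d r) (hr : 2 ≤ r) (hrk : r < k)
    (hn : 2 * (r + 1) ≤ n) (hd : 3 ≤ d) (hkr : ¬ k ≡ 1 [MOD r]) :
    (n : ℚ) ≤ (Fintype.card F : ℚ) + 1 + (k : ℚ) + (k : ℚ) / (r : ℚ) := by
  obtain ⟨hk, ⟨-, hmin⟩, hl, hopt⟩ := hC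
  unfold SingletonOptimalParams at hopt
  obtain ⟨t, ht⟩ : ∃ t, t = (k - 1) / r := ⟨_, rfl⟩
  have hdm := Nat.div_add_mod (k - 1) r
  have hlt := Nat.mod_lt (k - 1) (show 0 < r by omega)
  have hmod : (k - 1) % r ≠ 0 := by
    intro h
    apply hkr
    have : (1 : ℕ) ≡ k [MOD r] := (Nat.modEq_iff_dvd' (by omega)).2 (Nat.dvd_of_mod_eq_zero h)
    exact this.symm
  rw [← ht] at hdm
  have hr0 : (0 : ℚ) < r := by exact_mod_cast (show 0 < r by omega)
  have hceil : ⌈(k : ℚ) / (r : ℚ)⌉ = (t : ℤ) + 1 := by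
    rw [Int.ceil_eq_iff]
    push_cast
    constructor
    · rw [lt_div_iff₀ hr0]
      have : t * r < k := by rw [mul_comm]; omega
      have : (t * r : ℚ) < k := by exact_mod_cast this
      linarith
    · rw [div_le_iff₀ hr0]
      have : k ≤ (t + 1) * r := by rw [add_mul, mul_comm]; omega
      exact_mod_cast this
  have hlt' := Int.ceil_lt_add_one ((k : ℚ) / (r : ℚ))
  rw [hceil] at hopt hlt'
  obtain ⟨S, h1, h2⟩ := greedy C hk hl t (by omega)
  obtain ⟨D, hD, hDd⟩ := shorten C S hmin
  have hSn : S.card ≤ n := by simpa using Finset.card_le_univ S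
  have hne : D ≠ ⊥ := by
    intro h
    rw [h, finrank_bot] at hD
    omega
  obtain ⟨c, hc, hc0⟩ := Submodule.exists_mem_ne_zero_of_ne_bot hne
  have hex : ∃ δ, ∃ c ∈ D, c ≠ 0 ∧ hammingNorm c = δ := ⟨_, c, hc, hc0, rfl⟩
  classical
  obtain ⟨δ, hδ, hδm⟩ : ∃ δ, (∃ c ∈ D, c ≠ 0 ∧ hammingNorm c = δ) ∧
      ∀ c ∈ D, c ≠ 0 → δ ≤ hammingNorm c :=
    ⟨Nat.find hex, Nat.find_spec hex, fun c hc h0 => Nat.find_min' hex ⟨c, hc, h0, rfl⟩⟩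
  have hdδ : d ≤ δ := by
    obtain ⟨c, hc, h0, rfl⟩ := hδ
    exact hDd c hc h0
  have hs := singleton_bd D hD (by omega) hδm
  have hfin := hmds (n - S.card) _ δ D hD ⟨hδ, hδm⟩ (by omega) (by omega) (by omega)
  have hdq : d ≤ Fintype.card F + 1 := by omega
  have e1 : (d : ℚ) = n - k - (t + 1) + 2 := by exact_mod_cast hopt
  have e2 : (d : ℚ) ≤ Fintype.card F + 1 := by exact_mod_cast hdq
  push_cast at hlt'
  linarith
end

section
/- Assume that every nontrivial MDS code over F_q has length at most q+2 (the Main MDS Conjecture). Let C be a q-ary Singleton-optimal [n,k,d;r]-locally repairable code with r ≥ 2, r < k, n ≥ 2(r+1), d ≥ 3, and k ≢ 1 (mod r). Then d ≤ q + 3; consequently, if d = λn for some real λ with 0 < λ < 1, then n ≤ (q+3)/λ. -/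
open Finset

/-- vectors vanishing on `T` -/
def vanOn (F : Type*) [Field F] {n : ℕ} (T : Finset (Fin n)) : Submodule F (Fin n → F) where
  carrier := {c | ∀ i ∈ T, c i = 0}
  add_mem' := by
    intro a b ha hb i hi
    simp [ha i hi, hb i hi]
  zero_mem' := by intro i _; rfl
  smul_mem' := by
    intro a b hb i hi
    simp [hb i hi]

lemma finrank_le_van {F : Type*} [Field F] {n : ℕ} (W : Submodule F (Fin n → F))
    (U : Finset (Fin n)) :
    Module.finrank F W ≤ Module.finrank F ↥(W ⊓ vanOn F U) + U.card := by
  let f : W →ₗ[F] (U → F) := (LinearMap.funLeft F F (fun u : U => (u : Fin n))).comp W.subtype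
  have h1 := LinearMap.finrank_range_add_finrank_ker f
  have h2 : Module.finrank F (LinearMap.range f) ≤ U.card := by
    have := Submodule.finrank_le (LinearMap.range f)
    simpa using this
  have h3 : Module.finrank F (LinearMap.ker f) ≤ Module.finrank F ↥(W ⊓ vanOn F U) := by
    rw [← Submodule.finrank_map_subtype_eq W (LinearMap.ker f)]
    apply Submodule.finrank_mono
    rintro _ ⟨x, hx, rfl⟩
    refine ⟨x.2, ?_⟩
    intro i hi
    exact congrFun (LinearMap.mem_ker.1 hx) ⟨i, hi⟩
  omega

lemma exists_short {F : Type*} [Field F] {n k r : ℕ} (C : Submodule F (Fin n → F))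
    (hk : Module.finrank F C = k) (hl : HasLocality C r) :
    ∀ j : ℕ, j * r < k → ∃ T : Finset (Fin n),
      k + j ≤ Module.finrank F ↥(C ⊓ vanOn F T) + T.card ∧
      k ≤ Module.finrank F ↥(C ⊓ vanOn F T) + j * r := by
  intro j
  induction j with
  | zero =>
    intro _
    have := finrank_le_van C ∅
    refine ⟨∅, ?_⟩
    simp only [Finset.card_empty] at *
    omega
  | succ j ih =>
    intro hj
    have e1 : (j + 1) * r = j * r + r := by ring
    obtain ⟨T, h1, h2⟩ := ih (by omega)
    have hT : ∃ i, i ∉ T := by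
      by_contra! hT
      have : C ⊓ vanOn F T = ⊥ := by
        rw [eq_bot_iff]
        rintro x ⟨_, hx⟩
        rw [Submodule.mem_bot]
        funext i
        exact hx i (hT i)
      rw [this, finrank_bot] at h2
      omega
    obtain ⟨i, hi⟩ := hT
    obtain ⟨R, hR, hiR, hrec⟩ := hl i
    set U := (R \ T).erase i with hU
    have hUc : U.card + 1 = (R \ T).card := Finset.card_erase_add_one (by simp [hi, hiR])
    have hUr : (R \ T).card ≤ R.card := Finset.card_le_card Finset.sdiff_subset
    have hTR : (T ∪ R).card = T.card + U.card + 1 := by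
      have := Finset.card_sdiff_add_card R T
      rw [Finset.union_comm]
      omega
    have h3 := finrank_le_van (C ⊓ vanOn F T) U
    have h4 : C ⊓ vanOn F T ⊓ vanOn F U ≤ C ⊓ vanOn F (T ∪ R) := by
      rintro x ⟨⟨hxC, hxT⟩, hxU⟩
      have hx : ∀ j ∈ R, j ≠ i → x j = 0 := by
        intro j hj hji
        by_cases hjT : j ∈ T
        · exact hxT j hjT
        · exact hxU j (by simp [hU, hj, hji, hjT])
      refine ⟨hxC, ?_⟩
      intro j hj
      rcases Finset.mem_union.1 hj with hj | hj
      · exact hxT j hj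
      · by_cases hji : j = i
        · subst hji
          exact hrec x hxC 0 C.zero_mem hx
        · exact hx j hj hji
    have h5 := Submodule.finrank_mono h4
    refine ⟨T ∪ R, ?_, ?_⟩ <;> omega

/-- Singleton bound -/
lemma exists_low_weight {F : Type*} [Field F] [DecidableEq F] {m : ℕ}
    (D : Submodule F (Fin m → F)) (h : 1 ≤ Module.finrank F D) :
    ∃ c ∈ D, c ≠ 0 ∧ hammingNorm c + Module.finrank F D ≤ m + 1 := by
  have hle : Module.finrank F D ≤ m := by simpa using Submodule.finrank_le D
  obtain ⟨U, -, hU⟩ := Finset.exists_subset_card_eq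
    (s := (Finset.univ : Finset (Fin m))) (n := Module.finrank F D - 1) (by simp; omega)
  have h1 := finrank_le_van D U
  have h2 : D ⊓ vanOn F U ≠ ⊥ := by
    intro h2
    rw [h2, finrank_bot] at h1
    omega
  obtain ⟨c, ⟨hc, hcU⟩, hc0⟩ := Submodule.exists_mem_ne_zero_of_ne_bot h2
  refine ⟨c, hc, hc0, ?_⟩
  have h3 : hammingNorm c ≤ Uᶜ.card := by
    apply Finset.card_le_card
    intro i hi
    rw [Finset.mem_compl]
    intro hiU
    exact (Finset.mem_filter.1 hi).2 (hcU i hiU)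
  rw [Finset.card_compl, Fintype.card_fin] at h3
  omega

lemma main_bound {F : Type*} [Field F] [Fintype F] [DecidableEq F]
    (hmds : MDSConjecture F)
    {n k d r : ℕ} (C : Submodule F (Fin n → F))
    (hC : IsOptLRC C k d r) (hr : 2 ≤ r) (hrk : r < k)
    (hd : 3 ≤ d) (hkr : ¬ k ≡ 1 [MOD r]) :
    d ≤ Fintype.card F + 3 := by
  obtain ⟨hk, ⟨-, hmin⟩, hl, hopt⟩ := hC
  obtain ⟨j, hj⟩ : ∃ j, j = (k - 1) / r := ⟨_, rfl⟩
  have hj1 : j * r ≤ k - 1 := hj ▸ Nat.div_mul_le_self _ _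
  have hj2 : k - 1 < (j + 1) * r := by
    rw [hj, mul_comm]; exact Nat.lt_mul_div_succ _ (by omega)
  have hj3 : j * r + 2 ≤ k := by
    by_contra hcon
    apply hkr
    have : k = 1 + j * r := by omega
    rw [this]
    simp [Nat.ModEq]
  have hceil : ⌈(k : ℚ) / (r : ℚ)⌉ = (j : ℤ) + 1 := by
    have hr0 : (0 : ℚ) < r := by exact_mod_cast (by omega : 0 < r)
    rw [Int.ceil_eq_iff]
    constructor
    · rw [lt_div_iff₀ hr0]
      push_cast
      have : ((j * r : ℕ) : ℚ) < k := by exact_mod_cast (by omega : j * r < k)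
      push_cast at this
      linarith
    · rw [div_le_iff₀ hr0]
      exact_mod_cast (by omega : k ≤ (j + 1) * r)
  unfold SingletonOptimalParams at hopt
  rw [hceil] at hopt
  obtain ⟨T, h1, h2⟩ := exists_short C hk hl j (by omega)
  set K := C ⊓ vanOn F T with hK
  obtain ⟨m, hm⟩ : ∃ m, Tᶜ.card = m := ⟨_, rfl⟩
  have hTn : T.card + m = n := by
    have := Finset.card_add_card_compl T
    rw [hm, Fintype.card_fin] at this
    exact this
  let e := Tᶜ.orderEmbOfFin hm
  have he : ∀ i, i ∉ T → ∃ a, e a = i := by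
    intro i hi
    have : i ∈ Set.range e := by
      rw [Finset.range_orderEmbOfFin]
      simpa using hi
    exact this
  let g : K →ₗ[F] (Fin m → F) := (LinearMap.funLeft F F e).comp K.subtype
  have hg : ∀ x : K, ∀ a, g x a = (x : Fin n → F) (e a) := fun x a => rfl
  have hinj : Function.Injective g := by
    rw [injective_iff_map_eq_zero]
    intro x hx
    apply Subtype.ext
    funext i
    by_cases hi : i ∈ T
    · exact x.2.2 i hi
    · obtain ⟨a, rfl⟩ := he i hi
      exact congrFun hx a
  have hwt : ∀ x : K, hammingNorm (g x) = hammingNorm (x : Fin n → F) := by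
    intro x
    unfold hammingNorm
    apply Finset.card_bij (fun a _ => e a)
    · intro a ha
      simpa [hg] using ha
    · intro a _ b _ hab
      exact e.injective hab
    · intro i hi
      have hi' : (x : Fin n → F) i ≠ 0 := by simpa using hi
      obtain ⟨a, rfl⟩ := he i (fun hiT => hi' (x.2.2 i hiT))
      exact ⟨a, by simpa [hg] using hi', rfl⟩
  have hfr : Module.finrank F (LinearMap.range g) = Module.finrank F K :=
    LinearMap.finrank_range_of_inj hinj
  have hDmin : ∀ c ∈ LinearMap.range g, c ≠ 0 → d ≤ hammingNorm c := by
    rintro _ ⟨x, rfl⟩ hx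
    rw [hwt]
    apply hmin _ x.2.1
    intro h0
    apply hx
    rw [show x = 0 from Subtype.ext h0, map_zero]
  obtain ⟨c, hcD, hc0, hcw⟩ := exists_low_weight (LinearMap.range g) (by omega)
  have hcd := hDmin c hcD hc0
  have hfin := hmds m (Module.finrank F K) d (LinearMap.range g) hfr
    ⟨⟨c, hcD, hc0, by omega⟩, hDmin⟩ (by omega) (by omega) (by omega)
  omega

/-- Corollary 3.8: assuming the Main MDS Conjecture, a `q`-ary
Singleton-optimal `[n,k,d;r]`-LRC with `r ≥ 2`, `r < k`, `n ≥ 2(r+1)`, `d ≥ 3` and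
`k ≢ 1 (mod r)` satisfies `d ≤ q + 3`; consequently, if `d = λn` with `0 < λ < 1`,
then `n ≤ (q+3)/λ`. -/
theorem optLRC_dist_le_q_plus_three {F : Type*} [Field F] [Fintype F] [DecidableEq F]
    (hmds : MDSConjecture F)
    {n k d r : ℕ} (C : Submodule F (Fin n → F))
    (hC : IsOptLRC C k d r) (hr : 2 ≤ r) (hrk : r < k)
    (hn : 2 * (r + 1) ≤ n) (hd : 3 ≤ d) (hkr : ¬ k ≡ 1 [MOD r]) :
    d ≤ Fintype.card F + 3 ∧
    ∀ lam : ℝ, 0 < lam → lam < 1 → (d : ℝ) = lam * (n : ℝ) →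
      (n : ℝ) ≤ ((Fintype.card F : ℝ) + 3) / lam := by
  have hb := main_bound hmds C hC hr hrk hd hkr
  refine ⟨hb, ?_⟩
  intro lam h0 _ hdl
  rw [le_div_iff₀ h0, mul_comm, ← hdl]
  exact_mod_cast hb
end

section
/- Assume that every nontrivial MDS code over F_q has length at most q+2 (the Main MDS Conjecture). Let C be a q-ary Singleton-optimal [n,k,d;r]-locally repairable code with d = 5, r ∈ {2,3}, r < k and n ≥ 2(r+1). Then n ≤ ((r+1)(q+2) + (r+2)(4r−1)) / r; in particular n = O(q). -/
open Finset

section Helpers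

lemma aux_dualword {F : Type*} [Field F] [Fintype F] [DecidableEq F] {n r : ℕ}
    (C : Submodule F (Fin n → F)) (h : HasLocality C r) (i : Fin n) :
    ∃ x : Fin n → F, InDual C x ∧ hammingNorm x ≤ r + 1 ∧ x i ≠ 0 := by
  classical
  obtain ⟨R, hR, hi, hrec⟩ := h i
  let f : Fin n → (↥C →ₗ[F] F) := fun j => (LinearMap.proj j) ∘ₗ C.subtype
  have hmem : f i ∈ Submodule.span F (Set.range (fun j : ↥(R.erase i) => f j.1)) := by
    apply mem_span_of_iInf_ker_le_ker
    intro u hu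
    simp only [Submodule.mem_iInf, LinearMap.mem_ker] at hu ⊢
    have := hrec u.1 u.2 0 C.zero_mem (fun j hj hji => by
      have := hu ⟨j, Finset.mem_erase.2 ⟨hji, hj⟩⟩
      simpa [f] using this)
    simpa [f] using this
  rw [Submodule.mem_span_range_iff_exists_fun] at hmem
  obtain ⟨c, hc⟩ := hmem
  let x : Fin n → F := fun j => if hj : j ∈ R.erase i then c ⟨j, hj⟩ else (if j = i then -1 else 0)
  refine ⟨x, ?_, ?_, ?_⟩
  · intro u hu
    have h1 := congrArg (fun g : ↥C →ₗ[F] F => g ⟨u, hu⟩) hc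
    simp only [LinearMap.sum_apply, LinearMap.smul_apply, f, LinearMap.comp_apply,
      Submodule.subtype_apply, LinearMap.proj_apply, smul_eq_mul] at h1
    have h2 : ∑ j, x j * u j = ∑ j ∈ R, x j * u j := by
      symm
      apply Finset.sum_subset (Finset.subset_univ _)
      intro j _ hj
      have h3 : j ∉ R.erase i := fun h => hj (Finset.mem_of_mem_erase h)
      have h4 : j ≠ i := fun h => hj (h ▸ hi)
      simp [x, hj, h4]
    rw [h2, ← Finset.sum_erase_add _ _ hi, ← Finset.sum_coe_sort (R.erase i)]
    have h5 : ∑ j : ↥(R.erase i), x j.1 * u j.1 = u i := by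
      rw [← h1]
      apply Finset.sum_congr rfl
      rintro ⟨j, hj⟩ _
      simp only [x, dif_pos hj]
    rw [h5]
    simp [x]
  · refine le_trans ?_ hR
    unfold hammingNorm
    apply Finset.card_le_card
    intro j hj
    by_contra hjR
    have h3 : j ∉ R.erase i := fun h => hjR (Finset.mem_of_mem_erase h)
    have h4 : j ≠ i := fun h => hjR (h ▸ hi)
    simp [x, hjR, h4] at hj
  · simp [x]

lemma aux_pack {F : Type*} [Field F] [Fintype F] [DecidableEq F] {n : ℕ}
    (C : Submodule F (Fin n → F)) (hd : ∀ c ∈ C, c ≠ 0 → 5 ≤ hammingNorm c)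
    (B : Finset (Fin n → F)) (hB : LinearIndependent F (fun x : ↥B => (x : Fin n → F)))
    (hdual : ∀ x ∈ B, InDual C x)
    (W : Finset (Fin n → F)) (hW : ∀ w ∈ W, ∀ x ∈ B, ∑ i, x i * w i = 0)
    (hW2 : ∀ w ∈ W, ∀ w' ∈ W, hammingNorm (w - w') ≤ 4) :
    W.card * Fintype.card F ^ (Module.finrank F ↥C + B.card) ≤ Fintype.card F ^ n := by
  classical
  let M : Matrix ↥B (Fin n) F := fun x => x.1
  have hrank : M.rank = B.card := by
    have := LinearIndependent.rank_matrix (M := M) hB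
    simpa using this
  have hker : Module.finrank F (LinearMap.ker M.mulVecLin) + B.card = n := by
    have := LinearMap.finrank_range_add_finrank_ker M.mulVecLin
    rw [Module.finrank_fin_fun] at this
    rw [← hrank, Matrix.rank]
    omega
  have hmemE : ∀ y : Fin n → F, (∀ x ∈ B, ∑ i, x i * y i = 0) →
      y ∈ LinearMap.ker M.mulVecLin := by
    intro y hy
    rw [LinearMap.mem_ker]
    ext x
    exact hy x.1 x.2
  let Φ : ↥C × ↥W → ↥(LinearMap.ker M.mulVecLin) := fun p =>
    ⟨p.1.1 + p.2.1, Submodule.add_mem _ (hmemE _ (fun x hx => hdual x hx _ p.1.2))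
      (hmemE _ (hW _ p.2.2))⟩
  have hinj : Function.Injective Φ := by
    rintro ⟨c, w⟩ ⟨c', w'⟩ h
    have h1 : c.1 + w.1 = c'.1 + w'.1 := congrArg Subtype.val h
    have h2 : w'.1 - w.1 = c.1 - c'.1 := by
      rw [sub_eq_sub_iff_add_eq_add, add_comm, ← h1, add_comm]
    have h3 : c.1 - c'.1 ∈ C := C.sub_mem c.2 c'.2
    have h4 : c.1 - c'.1 = 0 := by
      by_contra hne
      have := hd _ h3 hne
      rw [← h2] at this
      have := hW2 _ w'.2 _ w.2
      omega
    have h5 : c = c' := Subtype.ext (sub_eq_zero.1 h4)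
    rw [h4] at h2
    have h6 : w = w' := (Subtype.ext (sub_eq_zero.1 h2)).symm
    rw [h5, h6]
  have hcard := Nat.card_le_card_of_injective Φ hinj
  rw [Nat.card_prod, Module.natCard_eq_pow_finrank (K := F) (V := ↥C),
    Module.natCard_eq_pow_finrank (K := F) (V := ↥(LinearMap.ker M.mulVecLin))] at hcard
  simp only [Nat.card_eq_fintype_card, Fintype.card_coe] at hcard
  calc W.card * Fintype.card F ^ (Module.finrank F ↥C + B.card)
      = (Fintype.card F ^ Module.finrank F ↥C * W.card) * Fintype.card F ^ B.card := by ring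
    _ ≤ Fintype.card F ^ Module.finrank F (LinearMap.ker M.mulVecLin)
          * Fintype.card F ^ B.card := Nat.mul_le_mul_right _ hcard
    _ = Fintype.card F ^ n := by rw [← pow_add, hker]

/-- support -/
def auxSupp {F : Type*} [Field F] [DecidableEq F] {n : ℕ} (x : Fin n → F) : Finset (Fin n) :=
  Finset.univ.filter fun i => x i ≠ 0

/-- private part -/
def auxPriv {α β : Type*} [DecidableEq α] [DecidableEq β] (B : Finset β) (S : β → Finset α)
    (x : β) : Finset α := (S x) \ (B.erase x).biUnion S

lemma aux_union {F : Type*} [Field F] [Fintype F] [DecidableEq F] {n : ℕ}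
    (C : Submodule F (Fin n → F)) (hd : ∀ c ∈ C, c ≠ 0 → 5 ≤ hammingNorm c)
    (B : Finset (Fin n → F)) (hB : LinearIndependent F (fun x : ↥B => (x : Fin n → F)))
    (hdual : ∀ x ∈ B, InDual C x) (hcard : n ≤ Module.finrank F ↥C + B.card + 3) :
    n ≤ (B.biUnion auxSupp).card + 3 := by
  classical
  by_contra hlt
  have h1 : 4 ≤ (B.biUnion auxSupp)ᶜ.card := by
    rw [Finset.card_compl, Fintype.card_fin]; omega
  obtain ⟨T, hT, hT4⟩ := Finset.exists_subset_card_eq h1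
  let g : (↥T → F) → (Fin n → F) := fun v j => if hj : j ∈ T then v ⟨j, hj⟩ else 0
  have hg : Function.Injective g := by
    intro v v' h
    ext ⟨j, hj⟩
    have := congrFun h j
    simpa [g, hj] using this
  have h0 : ∀ v, ∀ j ∉ T, g v j = 0 := by
    intro v j hj; simp [g, hj]
  have := aux_pack C hd B hB hdual (Finset.univ.image g) (by
      intro w hw x hx
      obtain ⟨v, -, rfl⟩ := Finset.mem_image.1 hw
      apply Finset.sum_eq_zero
      intro i _
      by_cases hi : i ∈ T
      · have := Finset.mem_compl.1 (hT hi)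
        have h2 : x i = 0 := by
          by_contra hne
          exact this (Finset.mem_biUnion.2 ⟨x, hx, by simp [auxSupp, hne]⟩)
        rw [h2, zero_mul]
      · rw [h0 v i hi, mul_zero]) (by
      intro w hw w' hw'
      obtain ⟨v, -, rfl⟩ := Finset.mem_image.1 hw
      obtain ⟨v', -, rfl⟩ := Finset.mem_image.1 hw'
      rw [← hT4]
      apply Finset.card_le_card
      intro j hj
      by_contra hjT
      simp [h0 v j hjT, h0 v' j hjT] at hj)
  rw [Finset.card_image_of_injective _ hg, Finset.card_univ, Fintype.card_fun, Fintype.card_coe,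
    hT4, ← pow_add] at this
  have := (Nat.pow_le_pow_iff_right (Fintype.one_lt_card (α := F))).1 this
  omega

lemma aux_count {α β : Type*} [DecidableEq α] [DecidableEq β] (B : Finset β) (S : β → Finset α)
    (s : ℕ) (hS : ∀ x ∈ B, (S x).card ≤ s) :
    2 * (B.biUnion S).card ≤ s * B.card + ∑ x ∈ B, (auxPriv B S x).card := by
  have key : 2 * (B.biUnion S).card ≤ ∑ x ∈ B, ((S x).card + (auxPriv B S x).card) := by
    have h1 : ∀ x ∈ B, (S x).card + (auxPriv B S x).card =
        ∑ e ∈ B.biUnion S, ((if e ∈ S x then 1 else 0) + (if e ∈ auxPriv B S x then 1 else 0)) := by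
      intro x hx
      have hs : S x ⊆ B.biUnion S := Finset.subset_biUnion_of_mem S hx
      have hs' : auxPriv B S x ⊆ B.biUnion S := Finset.sdiff_subset.trans hs
      rw [Finset.sum_add_distrib, ← Finset.card_filter, ← Finset.card_filter,
        Finset.filter_mem_eq_inter, Finset.filter_mem_eq_inter,
        Finset.inter_eq_right.2 hs, Finset.inter_eq_right.2 hs']
    rw [Finset.sum_congr rfl h1, Finset.sum_comm, mul_comm, ← smul_eq_mul]
    apply Finset.card_nsmul_le_sum
    intro e he
    obtain ⟨x, hx, hex⟩ := Finset.mem_biUnion.1 he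
    by_cases hp : e ∈ auxPriv B S x
    · refine le_trans ?_ (Finset.single_le_sum (fun _ _ => Nat.zero_le _) hx)
      simp [hex, hp]
    · have : ∃ y ∈ B, y ≠ x ∧ e ∈ S y := by
        simp only [auxPriv, Finset.mem_sdiff, hex, true_and, not_not, Finset.mem_biUnion,
          Finset.mem_erase] at hp
        obtain ⟨y, ⟨h1, h2⟩, h3⟩ := hp
        exact ⟨y, h2, h1, h3⟩
      obtain ⟨y, hy, hyx, hey⟩ := this
      have hsub : ({x, y} : Finset β) ⊆ B := by
        intro z hz
        simp only [Finset.mem_insert, Finset.mem_singleton] at hz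
        rcases hz with rfl | rfl <;> assumption
      refine le_trans ?_ (Finset.sum_le_sum_of_subset hsub)
      rw [Finset.sum_pair hyx.symm]
      simp only [hex, hey, if_true]
      omega
  refine key.trans ?_
  rw [Finset.sum_add_distrib, mul_comm s, ← smul_eq_mul]
  exact Nat.add_le_add_right (Finset.sum_le_card_nsmul _ _ _ hS) _

lemma aux_priv {α β : Type*} [DecidableEq α] [DecidableEq β] (B : Finset β) (S : β → Finset α)
    (x : β) (hx : x ∈ B) :
    (B.biUnion S).card = (auxPriv B S x).card + ((B.erase x).biUnion S).card := by
  rw [auxPriv, ← Finset.card_union_of_disjoint Finset.sdiff_disjoint,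
    Finset.sdiff_union_self_eq_union]
  congr 1
  conv_lhs => rw [← Finset.insert_erase hx]
  rw [Finset.biUnion_insert]

lemma aux_exists {F : Type*} [Field F] [Fintype F] [DecidableEq F] {n r A : ℕ}
    (C : Submodule F (Fin n → F)) (h : HasLocality C r) (hA : (r + 1) * A < n) :
    ∃ B : Finset (Fin n → F), LinearIndependent F (fun x : ↥B => (x : Fin n → F)) ∧
      (∀ x ∈ B, InDual C x) ∧ (∀ x ∈ B, (auxSupp x).card ≤ r + 1) ∧ B.card = A + 1 := by
  classical
  obtain ⟨b, hbs, hspan, hli⟩ := exists_linearIndependent F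
    {x : Fin n → F | InDual C x ∧ hammingNorm x ≤ r + 1}
  have hfin : b.Finite := Set.toFinite b
  let B0 := hfin.toFinset
  have hcov : Finset.univ ⊆ B0.biUnion auxSupp := by
    intro i _
    by_contra hi
    obtain ⟨x, hx1, hx2, hx3⟩ := aux_dualword C h i
    have hx : x ∈ Submodule.span F b := by
      rw [hspan]; exact Submodule.subset_span ⟨hx1, hx2⟩
    have hle : Submodule.span F b ≤ LinearMap.ker (LinearMap.proj (R := F) (φ := fun _ : Fin n => F) i) := by
      rw [Submodule.span_le]
      intro y hy
      simp only [SetLike.mem_coe, LinearMap.mem_ker, LinearMap.proj_apply]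
      by_contra hne
      exact hi (Finset.mem_biUnion.2 ⟨y, by simpa [B0] using hy, by simp [auxSupp, hne]⟩)
    exact hx3 (by simpa using hle hx)
  have hc : n ≤ B0.card * (r + 1) := by
    have h1 := Finset.card_le_card hcov
    rw [Finset.card_univ, Fintype.card_fin] at h1
    refine h1.trans (Finset.card_biUnion_le_card_mul _ _ _ ?_)
    intro x hx
    exact (hbs (by simpa [B0] using hx)).2
  have hlt : A + 1 ≤ B0.card := by
    by_contra hcon
    have : B0.card ≤ A := by omega
    have := Nat.mul_le_mul_right (r + 1) this
    nlinarith
  obtain ⟨B, hBB, hBc⟩ := Finset.exists_subset_card_eq hlt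
  have hsub : ∀ x ∈ B, x ∈ b := fun x hx => by simpa [B0] using hBB hx
  refine ⟨B, ?_, fun x hx => (hbs (hsub x hx)).1, fun x hx => (hbs (hsub x hx)).2, hBc⟩
  exact LinearIndepOn.mono (v := id) (t := (B : Set (Fin n → F))) (s := b) hli hsub

lemma aux_dirs {F : Type*} [Field F] [Fintype F] [DecidableEq F] {n : ℕ}
    (C : Submodule F (Fin n → F)) (hd : ∀ c ∈ C, c ≠ 0 → 5 ≤ hammingNorm c)
    (B : Finset (Fin n → F)) (hB : LinearIndependent F (fun x : ↥B => (x : Fin n → F)))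
    (hdual : ∀ x ∈ B, InDual C x) (hcard : n = Module.finrank F ↥C + B.card + 2)
    (G : Finset (Fin n → F)) (hGB : G ⊆ B) (hG : ∀ x ∈ G, (auxSupp x).card = 3)
    (hpriv : ∀ x ∈ G, ∀ y ∈ B, ∀ i, x i ≠ 0 → y i ≠ 0 → x = y) :
    2 * G.card ≤ Fintype.card F + 2 := by
  classical
  have hpiv : ∀ x ∈ G, ∃ a : Fin n, x a ≠ 0 := by
    intro x hx
    have : 0 < (auxSupp x).card := by rw [hG x hx]; norm_num
    obtain ⟨a, ha⟩ := Finset.card_pos.1 this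
    exact ⟨a, by simpa [auxSupp] using ha⟩
  haveI : Nonempty (Fin n) := ⟨⟨0, by omega⟩⟩
  choose! a ha using hpiv
  let J : Finset (Σ _ : (Fin n → F), Fin n) := G.sigma (fun x => (auxSupp x).erase (a x))
  have hJ : J.card = G.card * 2 := by
    rw [Finset.card_sigma]
    apply Finset.sum_const_nat
    intro x hx
    rw [Finset.card_erase_of_mem (by simp [auxSupp, ha x hx]), hG x hx]
  have hJm : ∀ p ∈ J, p.1 ∈ G ∧ p.2 ≠ a p.1 ∧ p.1 p.2 ≠ 0 := by
    intro p hp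
    simpa [J, auxSupp, Finset.mem_sigma] using hp
  let w : (Σ _ : (Fin n → F), Fin n) × F → (Fin n → F) := fun p =>
    Pi.single (a p.1.1) p.2 - Pi.single p.1.2 (p.2 * p.1.1 (a p.1.1) / p.1.1 p.1.2)
  let I := J ×ˢ (Finset.univ.erase (0 : F))
  have hIm : ∀ p ∈ I, p.1 ∈ J ∧ p.2 ≠ 0 := by
    intro p hp; simpa [I] using hp
  have hwa : ∀ p ∈ I, w p (a p.1.1) = p.2 := by
    intro p hp
    have := (hJm _ (hIm p hp).1).2.1
    simp [w, Pi.single_apply, this.symm]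
  have hwb : ∀ p ∈ I, w p p.1.2 ≠ 0 := by
    intro p hp
    obtain ⟨h1, h2, h3⟩ := hJm _ (hIm p hp).1
    have h4 := (hIm p hp).2
    have h5 := ha _ h1
    simp [w, Pi.single_apply, h2, h3, h4, h5]
  have hwz : ∀ p, ∀ j, j ≠ a p.1.1 → j ≠ p.1.2 → w p j = 0 := by
    intro p j h1 h2
    simp [w, Pi.single_apply, h1, h2]
  have hinj : Set.InjOn w I := by
    rintro p hp p' hp' h
    have hp := Finset.mem_coe.1 hp
    have hp' := Finset.mem_coe.1 hp'
    obtain ⟨h1, h2, h3⟩ := hJm _ (hIm p hp).1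
    obtain ⟨h1', h2', h3'⟩ := hJm _ (hIm p' hp').1
    have hb := hwb p hp
    rw [h] at hb
    have hor : p.1.2 = a p'.1.1 ∨ p.1.2 = p'.1.2 := by
      by_contra hcon
      push Not at hcon
      exact hb (hwz p' _ hcon.1 hcon.2)
    have hx : p.1.1 = p'.1.1 := by
      apply hpriv _ h1 _ (hGB h1') p.1.2 h3
      rcases hor with h' | h' <;> rw [h']
      · exact ha _ h1'
      · exact h3'
    have hbb : p.1.2 = p'.1.2 := by
      rcases hor with h' | h'
      · rw [← hx] at h'; exact absurd h' h2
      · exact h'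
    have ht : p.2 = p'.2 := by
      rw [← hwa p hp, ← hwa p' hp', h, hx]
    obtain ⟨⟨x, b⟩, t⟩ := p
    obtain ⟨⟨x', b'⟩, t'⟩ := p'
    simp only at hx hbb ht
    subst hx hbb ht
    rfl
  have hnorm : ∀ p, ∀ p', hammingNorm (w p - w p') ≤ 4 := by
    intro p p'
    refine le_trans (Finset.card_le_card (t := {a p.1.1, p.1.2, a p'.1.1, p'.1.2}) ?_)
      Finset.card_le_four
    intro j hj
    by_contra hcon
    simp only [Finset.mem_insert, Finset.mem_singleton, not_or] at hcon
    obtain ⟨c1, c2, c3, c4⟩ := hcon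
    simp [hwz p j c1 c2, hwz p' j c3 c4] at hj
  have := aux_pack C hd B hB hdual (I.image w) (by
      intro v hv y hy
      obtain ⟨p, hp, rfl⟩ := Finset.mem_image.1 hv
      obtain ⟨h1, h2, h3⟩ := hJm _ (hIm p hp).1
      have hsum : ∑ i, y i * w p i = y (a p.1.1) * p.2 -
          y p.1.2 * (p.2 * p.1.1 (a p.1.1) / p.1.1 p.1.2) := by
        simp [w, mul_sub, Finset.sum_sub_distrib, Pi.single_apply]
      rw [hsum]
      by_cases hy1 : p.1.1 = y
      · rw [← hy1]; field_simp; ring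
      · have e1 : y (a p.1.1) = 0 := by
          by_contra hne
          exact hy1 (hpriv _ h1 _ hy _ (ha _ h1) hne)
        have e2 : y p.1.2 = 0 := by
          by_contra hne
          exact hy1 (hpriv _ h1 _ hy _ h3 hne)
        rw [e1, e2]; ring) (by
      intro v hv v' hv'
      obtain ⟨p, -, rfl⟩ := Finset.mem_image.1 hv
      obtain ⟨p', -, rfl⟩ := Finset.mem_image.1 hv'
      exact hnorm p p')
  rw [Finset.card_image_of_injOn hinj] at this
  have hIc : I.card = G.card * 2 * (Fintype.card F - 1) := by
    rw [Finset.card_product, hJ, Finset.card_erase_of_mem (Finset.mem_univ _), Finset.card_univ]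
  have hq : 1 < Fintype.card F := Fintype.one_lt_card
  have hle : I.card ≤ Fintype.card F ^ 2 := by
    have hpos : 0 < Fintype.card F ^ (Module.finrank F ↥C + B.card) := by positivity
    refine Nat.le_of_mul_le_mul_right (this.trans (le_of_eq ?_)) hpos
    rw [← pow_add]; congr 1; omega
  rw [hIc] at hle
  obtain ⟨m, hm⟩ : ∃ m, Fintype.card F = m + 2 := ⟨Fintype.card F - 2, by omega⟩
  rw [hm] at hle ⊢
  have e : m + 2 - 1 = m + 1 := rfl
  rw [e] at hle
  by_contra hcon
  have : m + 5 ≤ G.card * 2 := by omega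
  nlinarith [Nat.mul_le_mul_right (m + 1) this]

end Helpers

/-- Theorem 3.10 (ii): assuming the Main MDS Conjecture, a `q`-ary
Singleton-optimal `[n,k,5;r]`-LRC with `r ∈ {2,3}`, `r < k` and `n ≥ 2(r+1)` satisfies
`n ≤ ((r+1)(q+2) + (r+2)(4r-1))/r`; in particular `n = O(q)`. -/
theorem optLRC_d5_r23 {F : Type*} [Field F] [Fintype F] [DecidableEq F]
    (hmds : MDSConjecture F)
    {n k r : ℕ} (C : Submodule F (Fin n → F))
    (hC : IsOptLRC C k 5 r) (hr : r = 2 ∨ r = 3) (hrk : r < k)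
    (hn : 2 * (r + 1) ≤ n) :
    (n : ℚ) ≤ (((r : ℚ) + 1) * ((Fintype.card F : ℚ) + 2) +
      ((r : ℚ) + 2) * (4 * (r : ℚ) - 1)) / (r : ℚ) := by
  classical
  obtain ⟨hk, ⟨-, hd⟩, hloc, hopt⟩ := hC
  have hr0 : 0 < r := by omega
  have hrq : (0 : ℚ) < r := by exact_mod_cast hr0
  obtain ⟨A, hA⟩ : ∃ A : ℕ, ⌈(k : ℚ) / (r : ℚ)⌉ = (A : ℤ) :=
    Int.eq_ofNat_of_zero_le (Int.ceil_nonneg (by positivity))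
  have hn1 : n = k + A + 3 := by
    unfold SingletonOptimalParams at hopt
    rw [hA] at hopt
    push_cast at hopt
    omega
  have hk1 : k ≤ r * A := by
    have h1 := Int.le_ceil ((k : ℚ) / (r : ℚ))
    rw [hA, div_le_iff₀ hrq] at h1
    have : (k : ℚ) ≤ (r * A : ℕ) := by push_cast at h1 ⊢; linarith
    exact_mod_cast this
  have hk2 : r * A < k + r := by
    have h1 := Int.ceil_lt_add_one ((k : ℚ) / (r : ℚ))
    rw [hA] at h1
    have h2 : (k : ℚ) / r * r = k := div_mul_cancel₀ _ hrq.ne'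
    have : ((r * A : ℕ) : ℚ) < (k + r : ℕ) := by
      push_cast at h1 ⊢
      nlinarith
    exact_mod_cast this
  have hq : 2 ≤ Fintype.card F := Fintype.one_lt_card
  obtain ⟨B, hBli, hBd, hBs, hBc⟩ := aux_exists (A := A) C hloc (by
    rcases hr with rfl | rfl <;> omega)
  have hoth : ∀ x ∈ B, n ≤ ((B.erase x).biUnion auxSupp).card + 3 := by
    intro x hx
    refine aux_union C hd (B.erase x) ?_ (fun y hy => hBd y (Finset.mem_of_mem_erase hy)) ?_
    · exact LinearIndepOn.mono (v := id) (t := ((B.erase x : Finset (Fin n → F)) : Set (Fin n → F)))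
        (s := (B : Set (Fin n → F))) hBli (Finset.coe_subset.2 (Finset.erase_subset _ _))
    · rw [Finset.card_erase_of_mem hx, hBc]; omega
  have hU : (B.biUnion auxSupp).card ≤ n := by
    simpa using Finset.card_le_univ (B.biUnion (auxSupp (F := F) (n := n)))
  have hp3 : ∀ x ∈ B, (auxPriv B auxSupp x).card ≤ 3 := by
    intro x hx
    have h1 := aux_priv B auxSupp x hx
    have h2 := hoth x hx
    omega
  have hcount := aux_count B auxSupp (r + 1) hBs
  have hBne : B.Nonempty := Finset.card_pos.1 (by omega)
  obtain ⟨x0, hx0, hmax⟩ := Finset.exists_max_image B (fun x => (auxPriv B auxSupp x).card) hBne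
  have hP : ∑ x ∈ B, (auxPriv B auxSupp x).card ≤ B.card * (auxPriv B auxSupp x0).card := by
    rw [← smul_eq_mul]
    exact Finset.sum_le_card_nsmul _ _ _ hmax
  have hpx := aux_priv B auxSupp x0 hx0
  have hox := hoth x0 hx0
  have hp3x := hp3 x0 hx0
  generalize hpdef : (auxPriv B auxSupp x0).card = p at *
  generalize hUdef : (B.biUnion auxSupp).card = U at *
  generalize hOdef : ((B.erase x0).biUnion auxSupp).card = O at *
  rw [hBc] at hcount hP
  rw [le_div_iff₀ hrq]
  rcases hr with rfl | rfl
  · suffices h : n * 2 ≤ 3 * (Fintype.card F + 2) + 28 by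
      have : ((n * 2 : ℕ) : ℚ) ≤ (3 * (Fintype.card F + 2) + 28 : ℕ) := by exact_mod_cast h
      push_cast at this ⊢
      linarith
    by_cases hA3 : A ≤ 3
    · omega
    have hp : p = 3 := by
      interval_cases p <;> omega
    subst hp
    let G := B.filter (fun x => (auxPriv B auxSupp x).card = 3)
    have hG1 : ∑ x ∈ B, (auxPriv B auxSupp x).card ≤ ∑ x ∈ B, (2 +
        if (auxPriv B auxSupp x).card = 3 then 1 else 0) := by
      apply Finset.sum_le_sum
      intro x hx
      have := hp3 x hx
      split_ifs <;> omega
    rw [Finset.sum_add_distrib, ← Finset.card_filter, Finset.sum_const, smul_eq_mul, hBc] at hG1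
    have hpe : ∀ x ∈ G, auxPriv B auxSupp x = auxSupp x ∧ (auxSupp x).card = 3 := by
      intro x hx
      obtain ⟨hxB, hx3⟩ := Finset.mem_filter.1 hx
      have hle : auxPriv B auxSupp x ⊆ auxSupp x := Finset.sdiff_subset
      have h1 := hBs x hxB
      have h2 := Finset.eq_of_subset_of_card_le hle (by omega)
      exact ⟨h2, by rw [← h2]; exact hx3⟩
    have hdirs := aux_dirs C hd B hBli hBd (by omega) G (Finset.filter_subset _ _)
      (fun x hx => (hpe x hx).2) (by
        intro x hx y hy i hxi hyi
        by_contra hne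
        have h1 : i ∈ auxPriv B auxSupp x := by
          rw [(hpe x hx).1]; simp [auxSupp, hxi]
        rw [auxPriv, Finset.mem_sdiff] at h1
        exact h1.2 (Finset.mem_biUnion.2 ⟨y, Finset.mem_erase.2 ⟨fun h => hne h.symm, hy⟩,
          by simp [auxSupp, hyi]⟩))
    change _ ≤ _ + G.card at hG1
    omega
  · suffices h : n * 3 ≤ 4 * (Fintype.card F + 2) + 55 by
      have : ((n * 3 : ℕ) : ℚ) ≤ (4 * (Fintype.card F + 2) + 55 : ℕ) := by exact_mod_cast h
      push_cast at this ⊢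
      linarith
    have hA5 : A ≤ 5 := by
      interval_cases p <;> omega
    omega
end

section
/- Let C be a q-ary Singleton-optimal [n,k,d;r]-locally repairable code with d = 5, r ≥ 4, r < k, n ≥ 2(r+1), and k ≡ 0, −1 or −2 (mod r). Then n < (r+5)(4r−1)/(r−3); in particular n = O(r). -/
open Finset

/-- The key property of a support of a dual codeword. -/
def IsCircuitLike {F : Type*} [Field F] {n : ℕ} (C : Submodule F (Fin n → F))
    (A : Finset (Fin n)) : Prop :=
  ∀ p ∈ A, ∀ c ∈ C, (∀ j ∈ A, j ≠ p → c j = 0) → c p = 0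

theorem exists_circuit {F : Type*} [Field F] [Fintype F] [DecidableEq F] {n : ℕ}
    (C : Submodule F (Fin n → F)) (i : Fin n) (R : Finset (Fin n))
    (hR : IsRecoverySet C i R) : ∃ A, i ∈ A ∧ A ⊆ R ∧ IsCircuitLike C A := by
  classical
  let L : {j // j ∈ R.erase i} → Module.Dual F C := fun j =>
    (LinearMap.proj j.1 : (Fin n → F) →ₗ[F] F) ∘ₗ C.subtype
  let K : Module.Dual F C := (LinearMap.proj i : (Fin n → F) →ₗ[F] F) ∘ₗ C.subtype
  have hK : K ∈ Submodule.span F (Set.range L) := by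
    apply mem_span_of_iInf_ker_le_ker
    intro c hc
    simp only [Submodule.mem_iInf, LinearMap.mem_ker] at hc ⊢
    have := hR.2 c.1 c.2 0 C.zero_mem (fun j hj hji => hc ⟨j, by simp [hj, hji]⟩)
    exact this
  obtain ⟨a, ha⟩ := (Submodule.mem_span_range_iff_exists_fun F).1 hK
  let h : Fin n → F := fun j => if hj : j ∈ R.erase i then a ⟨j, hj⟩ else if j = i then -1 else 0
  have hh : ∀ c ∈ C, ∑ j, h j * c j = 0 := by
    intro c hc
    have h1 := congrArg (fun f => f ⟨c, hc⟩) ha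
    simp [L, K] at h1
    have h2 : ∑ j, h j * c j = ∑ j ∈ insert i (R.erase i), h j * c j := by
      symm
      apply Finset.sum_subset (Finset.subset_univ _)
      intro j _ hj
      rw [Finset.mem_insert, not_or] at hj
      simp only [h]
      rw [dif_neg hj.2, if_neg hj.1, zero_mul]
    rw [h2, Finset.sum_insert (by simp), ← Finset.sum_coe_sort]
    have h3 : ∀ j : {j // j ∈ R.erase i}, h j.1 * c j.1 = a j * c j.1 := by
      intro j
      simp only [h]
      rw [dif_pos j.2]
    rw [Finset.sum_congr rfl (fun j _ => h3 j)]
    have h4 : h i = -1 := by simp [h]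
    rw [h4]
    have h5 : ∑ j : {j // j ∈ R.erase i}, a j * c j.1 = c i := h1
    rw [h5]; ring
  refine ⟨Finset.univ.filter (fun j => h j ≠ 0), by simp [h], ?_, ?_⟩
  · intro j hj
    by_contra hjR
    have : j ≠ i := fun e => hjR (e ▸ hR.1)
    simp [h, hjR, this] at hj
  · intro p hp c hc hz
    have h1 := hh c hc
    rw [Finset.sum_eq_single p] at h1
    · rcases mul_eq_zero.1 h1 with h2 | h2
      · simp [h2] at hp
      · exact h2
    · intro j _ hjp
      by_cases hj : h j = 0
      · simp [hj]
      · rw [hz j (by simpa using hj) hjp, mul_zero]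
    · simp

theorem dim_bound {F : Type*} [Field F] {n : ℕ} (C : Submodule F (Fin n → F))
    (T : Finset (Fin n)) (hT : ∀ c ∈ C, (∀ j, j ∉ T → c j = 0) → c = 0) :
    Module.finrank F C + T.card ≤ n := by
  classical
  let f : C →ₗ[F] ({j // j ∈ Tᶜ} → F) :=
    (LinearMap.pi fun j => (LinearMap.proj j.1 : (Fin n → F) →ₗ[F] F)) ∘ₗ C.subtype
  have hf : Function.Injective f := by
    rw [injective_iff_map_eq_zero]
    intro c hc
    apply Subtype.ext
    exact hT c.1 c.2 (fun j hj => congrFun hc ⟨j, by simpa using hj⟩)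
  have h1 := LinearMap.finrank_le_finrank_of_injective hf
  rw [Module.finrank_fintype_fun_eq_card, Fintype.card_coe, Finset.card_compl,
    Fintype.card_fin] at h1
  have := Finset.card_le_univ T
  rw [Fintype.card_fin] at this
  omega

theorem exists_min_cover {n : ℕ} (Q : Finset (Fin n) → Prop)
    (h : ∀ i, ∃ A, i ∈ A ∧ Q A) :
    ∃ P : Finset (Finset (Fin n)), (∀ A ∈ P, Q A) ∧ (∀ i, ∃ A ∈ P, i ∈ A) ∧
      ∀ A ∈ P, ∃ p ∈ A, ∀ B ∈ P, p ∈ B → B = A := by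
  classical
  let Z : Finset (Finset (Finset (Fin n))) :=
    Finset.univ.filter fun P => (∀ A ∈ P, Q A) ∧ (∀ i, ∃ A ∈ P, i ∈ A)
  have hZ : Z.Nonempty := by
    refine ⟨Finset.univ.filter Q, ?_⟩
    simp only [Z, Finset.mem_filter, Finset.mem_univ, true_and]
    exact ⟨fun A hA => hA, fun i => (h i).imp fun A hA => ⟨hA.2, hA.1⟩⟩
  obtain ⟨P, hP, hmin⟩ := Finset.exists_min_image Z Finset.card hZ
  have hP' := (Finset.mem_filter.1 hP).2
  refine ⟨P, hP'.1, hP'.2, ?_⟩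
  intro A hA
  by_contra hcon
  push Not at hcon
  have : P.erase A ∈ Z := by
    simp only [Z, Finset.mem_filter, Finset.mem_univ, true_and]
    refine ⟨fun B hB => hP'.1 B (Finset.mem_of_mem_erase hB), fun i => ?_⟩
    obtain ⟨B, hB, hi⟩ := hP'.2 i
    by_cases hBA : B = A
    · subst hBA
      obtain ⟨D, hD, hiD, hne⟩ := hcon i hi
      exact ⟨D, Finset.mem_erase.2 ⟨hne, hD⟩, hiD⟩
    · exact ⟨B, Finset.mem_erase.2 ⟨hBA, hB⟩, hi⟩
  have h1 := hmin _ this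
  have h2 := Finset.card_erase_lt_of_mem hA
  omega

theorem private_bound {F : Type*} [Field F] [DecidableEq F] {n : ℕ}
    (C : Submodule F (Fin n → F))
    (hd : ∀ c ∈ C, c ≠ 0 → 5 ≤ hammingNorm c)
    (P : Finset (Finset (Fin n))) (hP : ∀ A ∈ P, IsCircuitLike C A)
    (hpriv : ∀ A ∈ P, ∃ p ∈ A, ∀ B ∈ P, p ∈ B → B = A)
    (A : Finset (Fin n)) (hA : A ∈ P) (S : Finset (Fin n))
    (hS : ∀ s ∈ S, ∀ B ∈ P, s ∈ B → B = A) (hS4 : S.card ≤ 4) :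
    Module.finrank F C + S.card + P.card ≤ n + 1 := by
  classical
  haveI : Nonempty (Fin n) := ⟨(hpriv A hA).choose⟩
  choose! p hp1 hp2 using hpriv
  have hinj : Set.InjOn p ((P.erase A : Finset (Finset (Fin n))) : Set (Finset (Fin n))) := by
    intro B hB D hD hBD
    have hB := Finset.mem_of_mem_erase hB
    have hD := Finset.mem_of_mem_erase hD
    exact hp2 D hD B hB (hBD ▸ hp1 B hB)
  have hdisj : Disjoint S ((P.erase A).image p) := by
    rw [Finset.disjoint_left]
    intro s hs hs2
    obtain ⟨B, hB, rfl⟩ := Finset.mem_image.1 hs2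
    have hB' := Finset.mem_of_mem_erase hB
    exact Finset.ne_of_mem_erase hB (hS _ hs B hB' (hp1 B hB'))
  have key := dim_bound C (S ∪ (P.erase A).image p) (by
    intro c hc hz
    have h1 : ∀ B ∈ P.erase A, c (p B) = 0 := by
      intro B hB
      have hB' := Finset.mem_of_mem_erase hB
      apply hP B hB' _ (hp1 B hB') c hc
      intro j hj hjp
      apply hz
      intro hjT
      rcases Finset.mem_union.1 hjT with h | h
      · exact Finset.ne_of_mem_erase hB (hS _ h B hB' hj)
      · obtain ⟨D, hD, rfl⟩ := Finset.mem_image.1 h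
        have hD' := Finset.mem_of_mem_erase hD
        have := hp2 D hD' B hB' hj
        exact hjp (by rw [this])
    by_contra hne
    have h5 := hd c hc hne
    have : hammingNorm c ≤ S.card := by
      apply Finset.card_le_card
      intro j hj
      have hj : c j ≠ 0 := by simpa using hj
      by_contra hjS
      apply hj
      by_cases hjT : j ∈ (P.erase A).image p
      · obtain ⟨B, hB, rfl⟩ := Finset.mem_image.1 hjT
        exact h1 B hB
      · exact hz j (by simp only [Finset.mem_union, not_or]; exact ⟨hjS, hjT⟩)
    omega)
  rw [Finset.card_union_of_disjoint hdisj, Finset.card_image_of_injOn hinj,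
    Finset.card_erase_of_mem hA] at key
  have := Finset.card_pos.2 ⟨A, hA⟩
  omega

theorem sum_card_swap {n : ℕ} (P : Finset (Finset (Fin n)))
    (f : Finset (Fin n) → Finset (Fin n)) :
    ∑ A ∈ P, (f A).card = ∑ i : Fin n, (P.filter fun A => i ∈ f A).card := by
  classical
  simp only [Finset.card_filter]
  rw [Finset.sum_comm]
  apply Finset.sum_congr rfl
  intro A _
  simp

theorem cover_count {n : ℕ} (P : Finset (Finset (Fin n))) (hcov : ∀ i, ∃ A ∈ P, i ∈ A)
    (s t : ℕ) (hs : ∀ A ∈ P, A.card ≤ s) :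
    n ≤ P.card * s ∧ ((∀ A ∈ P, ∀ S ⊆ A, (∀ x ∈ S, ∀ B ∈ P, x ∈ B → B = A) → S.card ≤ t) →
      2 * n ≤ P.card * (s + t)) := by
  classical
  have h1 : ∑ A ∈ P, A.card ≤ P.card * s := by
    simpa using Finset.sum_le_card_nsmul P _ s hs
  have e1 := sum_card_swap P (fun A => A)
  constructor
  · have : n ≤ ∑ i : Fin n, (P.filter fun A => i ∈ A).card := by
      have := Finset.card_nsmul_le_sum (Finset.univ : Finset (Fin n))
        (fun i => (P.filter fun A => i ∈ A).card) 1 (fun i _ => by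
          obtain ⟨A, hA, hi⟩ := hcov i
          exact Finset.card_pos.2 ⟨A, by simp [hA, hi]⟩)
      simpa using this
    omega
  · intro ht
    let g : Finset (Fin n) → Finset (Fin n) := fun A => A.filter fun x => ∀ B ∈ P, x ∈ B → B = A
    have e2 := sum_card_swap P g
    have h2 : ∑ A ∈ P, (g A).card ≤ P.card * t := by
      have := Finset.sum_le_card_nsmul P (fun A => (g A).card) t (fun A hA =>
        ht A hA _ (Finset.filter_subset _ _) (fun x hx => (Finset.mem_filter.1 hx).2))
      simpa using this
    have h3 := Finset.card_nsmul_le_sum (Finset.univ : Finset (Fin n))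
        (fun i => (P.filter fun A => i ∈ A).card + (P.filter fun A => i ∈ g A).card) 2
        (fun i _ => by
          obtain ⟨A, hA, hi⟩ := hcov i
          have a1 : 0 < (P.filter fun A => i ∈ A).card := Finset.card_pos.2 ⟨A, by simp [hA, hi]⟩
          by_cases hg : i ∈ g A
          · have a2 : 0 < (P.filter fun A => i ∈ g A).card :=
              Finset.card_pos.2 ⟨A, by simp [hA, hg]⟩
            omega
          · have : ∃ B ∈ P, i ∈ B ∧ B ≠ A := by
              by_contra hcon
              push Not at hcon
              exact hg (Finset.mem_filter.2 ⟨hi, hcon⟩)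
            obtain ⟨B, hB, hiB, hne⟩ := this
            have : 1 < (P.filter fun A => i ∈ A).card :=
              Finset.one_lt_card.2 ⟨A, by simp [hA, hi], B, by simp [hB, hiB], hne.symm⟩
            omega)
    rw [Finset.sum_add_distrib] at h3
    simp only [Finset.card_univ, Fintype.card_fin, smul_eq_mul] at h3
    rw [mul_add]
    omega

/-- Theorem 3.10 (iii): a `q`-ary Singleton-optimal `[n,k,5;r]`-LRC
with `r ≥ 4`, `r < k`, `n ≥ 2(r+1)` and `k ≡ 0, -1` or `-2 (mod r)` satisfies
`n < (r+5)(4r-1)/(r-3)`; in particular `n = O(r)`. -/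
theorem optLRC_d5_large_r {F : Type*} [Field F] [Fintype F] [DecidableEq F]
    {n k r : ℕ} (C : Submodule F (Fin n → F))
    (hC : IsOptLRC C k 5 r) (hr : 4 ≤ r) (hrk : r < k)
    (hn : 2 * (r + 1) ≤ n)
    (hkmod : (k : ℤ) ≡ 0 [ZMOD (r : ℤ)] ∨ (k : ℤ) ≡ -1 [ZMOD (r : ℤ)] ∨
      (k : ℤ) ≡ -2 [ZMOD (r : ℤ)]) :
    (n : ℚ) < ((r : ℚ) + 5) * (4 * (r : ℚ) - 1) / ((r : ℚ) - 3) := by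
  classical
  obtain ⟨hk, ⟨-, hd⟩, hloc, hopt⟩ := hC
  have hr0 : (0 : ℤ) < r := by omega
  -- parameters
  have hpar : ∃ m e : ℕ, e ≤ 2 ∧ k + e = r * m ∧ n = k + m + 3 := by
    have : ∃ e : ℕ, e ≤ 2 ∧ r ∣ k + e := by
      rcases hkmod with h | h | h
      · refine ⟨0, by omega, ?_⟩
        have := (Int.modEq_iff_dvd.1 h.symm)
        zify; simpa using this
      · refine ⟨1, by omega, ?_⟩
        have := (Int.modEq_iff_dvd.1 h.symm)
        zify; simpa using this
      · refine ⟨2, by omega, ?_⟩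
        have := (Int.modEq_iff_dvd.1 h.symm)
        zify; simpa using this
    obtain ⟨e, he, m, hm⟩ := this
    refine ⟨m, e, he, hm, ?_⟩
    have hceil : ⌈(k : ℚ) / (r : ℚ)⌉ = (m : ℤ) := by
      have hrq : (0 : ℚ) < r := by exact_mod_cast hr0
      have hmq : (k : ℚ) + e = r * m := by exact_mod_cast hm
      have heq : (e : ℚ) ≤ 2 := by exact_mod_cast he
      have he0 : (0 : ℚ) ≤ e := by positivity
      have hr4 : (4 : ℚ) ≤ r := by exact_mod_cast hr
      rw [Int.ceil_eq_iff]
      constructor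
      · rw [lt_div_iff₀ hrq]; push_cast; nlinarith
      · rw [div_le_iff₀ hrq]; push_cast; nlinarith
    unfold SingletonOptimalParams at hopt
    rw [hceil] at hopt
    push_cast at hopt
    omega
  obtain ⟨m, e, he, hm, hnm⟩ := hpar
  obtain ⟨P, hPQ, hcov, hpriv⟩ := exists_min_cover
    (fun A => A.card ≤ r + 1 ∧ IsCircuitLike C A) (fun i => by
      obtain ⟨R, hR, hrec⟩ := hloc i
      obtain ⟨A, hi, hAR, hA⟩ := exists_circuit C i R hrec
      exact ⟨A, hi, (Finset.card_le_card hAR).trans hR, hA⟩)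
  have hPc : ∀ A ∈ P, IsCircuitLike C A := fun A hA => (hPQ A hA).2
  have hPs : ∀ A ∈ P, A.card ≤ r + 1 := fun A hA => (hPQ A hA).1
  have hn1 : n = (r + 1) * m + 3 - e := by
    rw [add_mul]; omega
  have hl1 : m + 1 ≤ P.card := by
    have h := (cover_count P hcov (r + 1) 0 hPs).1
    by_contra hcon
    have : P.card * (r + 1) ≤ m * (r + 1) := Nat.mul_le_mul_right _ (by omega)
    have := mul_comm m (r + 1)
    omega
  have hl2 : P.card ≤ m + 3 := by
    obtain ⟨A, hA⟩ : P.Nonempty := Finset.card_pos.1 (by omega)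
    obtain ⟨p, hp, hp2⟩ := hpriv A hA
    have := private_bound C hd P hPc hpriv A hA {p} (by simpa using hp2) (by simp)
    simp only [Finset.card_singleton] at this
    omega
  have h2n := (cover_count P hcov (r + 1) (m + 4 - P.card) hPs).2 (by
    intro A hA S _ hS
    by_contra hcon
    obtain ⟨S', hS'S, hS'c⟩ := Finset.exists_subset_card_eq
      (show m + 5 - P.card ≤ S.card by omega)
    have := private_bound C hd P hPc hpriv A hA S' (fun s hs => hS s (hS'S hs)) (by omega)
    omega)
  have hm4 : m ≤ 4 := by
    by_contra hcon
    have hn2 : (r + 1) * m + 1 ≤ n := by omega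
    have : P.card = m + 1 ∨ P.card = m + 2 ∨ P.card = m + 3 := by omega
    rcases this with h | h | h <;> rw [h] at h2n
    · rw [show m + 4 - (m + 1) = 3 by omega] at h2n
      nlinarith
    · rw [show m + 4 - (m + 2) = 2 by omega] at h2n
      nlinarith
    · rw [show m + 4 - (m + 3) = 1 by omega] at h2n
      nlinarith
  have hn3 : n ≤ 4 * r + 7 := by
    have : (r + 1) * m ≤ (r + 1) * 4 := Nat.mul_le_mul_left _ hm4
    omega
  have hr4 : (4 : ℚ) ≤ r := by exact_mod_cast hr
  have hn4 : (n : ℚ) ≤ 4 * r + 7 := by exact_mod_cast hn3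
  rw [lt_div_iff₀ (by linarith)]
  nlinarith
end

section
/- Let C be a q-ary Singleton-optimal [n,k,d;r]-locally repairable code with d = 6, r ≥ 5, r < k, n ≥ 2(r+1), and k ≡ 0, −1, −2 or −3 (mod r). Then n < (r+6)(5r−1)/(r−4); in particular n = O(r). -/
open Finset

section Aux

variable {F : Type*} [Field F]

lemma aux_recover {n : ℕ} [Fintype F] [DecidableEq F] (C : Submodule F (Fin n → F)) (i : Fin n)
    (R : Finset (Fin n)) (h : IsRecoverySet C i R) :
    ∃ φ ∈ C.dualAnnihilator, φ (Pi.single i 1) ≠ 0 ∧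
      ∀ j, φ (Pi.single j 1) ≠ 0 → j ∈ R := by
  classical
  obtain ⟨hi, h⟩ := h
  let L : {j // j ∈ R.erase i} → (C →ₗ[F] F) :=
    fun j => (LinearMap.proj (j : Fin n)).comp C.subtype
  let K : C →ₗ[F] F := (LinearMap.proj i).comp C.subtype
  have hK : K ∈ Submodule.span F (Set.range L) := by
    apply mem_span_of_iInf_ker_le_ker
    intro c hc
    simp only [Submodule.mem_iInf, LinearMap.mem_ker] at hc ⊢
    have := h c.1 c.2 0 C.zero_mem (fun j hj hji => hc ⟨j, Finset.mem_erase.2 ⟨hji, hj⟩⟩)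
    exact this
  obtain ⟨a, ha⟩ := (Submodule.mem_span_range_iff_exists_fun F).1 hK
  refine ⟨LinearMap.proj i - ∑ j, a j • LinearMap.proj (j : Fin n), ?_, ?_, ?_⟩
  · rw [Submodule.mem_dualAnnihilator]
    intro c hc
    have := LinearMap.congr_fun ha ⟨c, hc⟩
    simp only [LinearMap.sum_apply, LinearMap.smul_apply, L, K, LinearMap.comp_apply,
      Submodule.subtype_apply, LinearMap.proj_apply] at this
    simp only [LinearMap.sub_apply, LinearMap.sum_apply, LinearMap.smul_apply,
      LinearMap.proj_apply, this, sub_self]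
  · simp only [LinearMap.sub_apply, LinearMap.sum_apply, LinearMap.smul_apply,
      LinearMap.proj_apply, Pi.single_eq_same]
    rw [Finset.sum_eq_zero]
    · simp
    · intro j _
      rw [Pi.single_eq_of_ne (Finset.ne_of_mem_erase j.2)]; simp
  · intro j hj
    by_contra hjR
    apply hj
    simp only [LinearMap.sub_apply, LinearMap.sum_apply, LinearMap.smul_apply,
      LinearMap.proj_apply]
    rw [Finset.sum_eq_zero, Pi.single_eq_of_ne]
    · simp
    · rintro rfl; exact hjR hi
    · intro x _
      rw [Pi.single_eq_of_ne]; · simp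
      rintro hx; exact hjR (hx ▸ Finset.mem_of_mem_erase x.2)

/-- vectors supported on a set -/
lemma aux_supp {n : ℕ} (E : Finset (Fin n)) :
    ∃ V : Submodule F (Fin n → F), Module.finrank F V = E.card ∧
      (∀ v ∈ V, ∀ j, v j ≠ 0 → j ∈ E) ∧
      (∀ ψ : Module.Dual F (Fin n → F), (∀ j ∈ E, ψ (Pi.single j 1) = 0) → ∀ v ∈ V, ψ v = 0) := by
  classical
  let b : E → (Fin n → F) := fun j => Pi.single (j : Fin n) 1
  have hb : LinearIndependent F b := by
    have := (Pi.basisFun F (Fin n)).linearIndependent.comp (fun j : E => (j : Fin n))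
      Subtype.val_injective
    convert this using 1
    ext j; simp [b]
  refine ⟨Submodule.span F (Set.range b), ?_, ?_, ?_⟩
  · rw [finrank_span_eq_card hb]; simp
  · intro v hv j hj
    by_contra hjE
    apply hj
    have hle : Submodule.span F (Set.range b) ≤ LinearMap.ker (LinearMap.proj j : (Fin n → F) →ₗ[F] F) := by
      rw [Submodule.span_le]
      rintro _ ⟨x, rfl⟩
      simp only [SetLike.mem_coe, LinearMap.mem_ker, LinearMap.proj_apply, b]
      rw [Pi.single_eq_of_ne]
      rintro rfl; exact hjE x.2
    exact hle hv
  · intro ψ hψ v hv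
    have hle : Submodule.span F (Set.range b) ≤ LinearMap.ker ψ := by
      rw [Submodule.span_le]
      rintro _ ⟨x, rfl⟩
      exact hψ x x.2
    exact hle hv

lemma aux_excl {n k l : ℕ} [Fintype F] [DecidableEq F] (C : Submodule F (Fin n → F))
    (hk : Module.finrank F C = k) (hd : ∀ c ∈ C, c ≠ 0 → 6 ≤ hammingNorm c)
    (B : Finset (Module.Dual F (Fin n → F))) (hB : ∀ φ ∈ B, φ ∈ C.dualAnnihilator)
    (hli : LinearIndepOn F id (B : Set (Module.Dual F (Fin n → F))))
    (hl : n + 1 ≤ k + B.card + 4)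
    (φ : Module.Dual F (Fin n → F)) (hφ : φ ∈ B) (E : Finset (Fin n))
    (hE : ∀ i ∈ E, ∀ ψ ∈ B, ψ ≠ φ → ψ (Pi.single i 1) = 0) : E.card ≤ 4 := by
  classical
  by_contra hcon
  obtain ⟨E', hE'E, hE'⟩ := Finset.exists_subset_card_eq (show 5 ≤ E.card by omega)
  obtain ⟨V, hV, hVs, hVψ⟩ := aux_supp (F := F) E'
  let W := Submodule.span F ((B.erase φ : Finset _) : Set (Module.Dual F (Fin n → F)))
  have hW : Module.finrank F W = B.card - 1 := by
    have h1 : LinearIndepOn F id ((B.erase φ : Finset _) : Set (Module.Dual F (Fin n → F))) :=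
      hli.mono (by simpa using Finset.erase_subset φ B)
    rw [finrank_span_finset_eq_card h1, Finset.card_erase_of_mem hφ]
  have hA := Subspace.finrank_add_finrank_dualCoannihilator_eq W
  rw [Module.finrank_fin_fun] at hA
  have hle : V ⊔ C ≤ W.dualCoannihilator := by
    rw [← Submodule.le_dualAnnihilator_iff_le_dualCoannihilator, Submodule.span_le]
    intro ψ hψ
    have hψ' := Finset.mem_erase.1 (Finset.mem_coe.1 hψ)
    rw [SetLike.mem_coe, Submodule.dualAnnihilator_sup_eq, Submodule.mem_inf]
    refine ⟨?_, hB ψ hψ'.2⟩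
    rw [Submodule.mem_dualAnnihilator]
    exact hVψ ψ (fun j hj => hE j (hE'E hj) ψ hψ'.2 hψ'.1)
  have h2 := Submodule.finrank_mono hle
  have h3 := Submodule.finrank_sup_add_finrank_inf_eq V C
  have hpos : 0 < B.card := Finset.card_pos.2 ⟨φ, hφ⟩
  have h4 : 0 < Module.finrank F (V ⊓ C : Submodule F (Fin n → F)) := by omega
  have : Nontrivial (V ⊓ C : Submodule F (Fin n → F)) := Module.nontrivial_of_finrank_pos h4
  obtain ⟨⟨c, hc⟩, hc0⟩ := exists_ne (0 : (V ⊓ C : Submodule F (Fin n → F)))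
  have hc0' : c ≠ 0 := fun h => hc0 (Subtype.ext h)
  have h6 := hd c hc.2 hc0'
  have h7 : hammingNorm c ≤ E'.card := by
    unfold hammingNorm
    apply Finset.card_le_card
    intro j hj
    exact hVs c hc.1 j (Finset.mem_filter.1 hj).2
  omega

lemma aux_count_s14 {n r : ℕ} {β : Type*} [DecidableEq β] (B : Finset β) (P : β → Fin n → Prop)
    [∀ b i, Decidable (P b i)]
    (hw : ∀ b ∈ B, (univ.filter fun i => P b i).card ≤ r + 1)
    (hcov : ∀ i, ∃ b ∈ B, P b i) :
    n ≤ B.card * (r + 1) ∧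
    ((∀ b ∈ B, ∀ E : Finset (Fin n), (∀ i ∈ E, ∀ b' ∈ B, b' ≠ b → ¬ P b' i) → E.card ≤ 4) →
      2 * n ≤ B.card * (r + 5)) := by
  classical
  have hs : ∑ i : Fin n, (B.filter fun b => P b i).card ≤ B.card * (r + 1) := by
    simp only [Finset.card_filter]
    rw [Finset.sum_comm]
    simp only [← Finset.card_filter]
    exact (Finset.sum_le_card_nsmul _ _ _ hw).trans (by simp)
  constructor
  · refine le_trans ?_ hs
    have : ∑ i : Fin n, 1 ≤ ∑ i : Fin n, (B.filter fun b => P b i).card := by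
      apply Finset.sum_le_sum
      intro i _
      obtain ⟨b, hb, hbi⟩ := hcov i
      exact Finset.card_pos.2 ⟨b, Finset.mem_filter.2 ⟨hb, hbi⟩⟩
    simpa using this
  · intro hE
    have hs2 : ∑ i : Fin n, (B.filter fun b => ∀ b' ∈ B, b' ≠ b → ¬ P b' i).card
        ≤ B.card * 4 := by
      simp only [Finset.card_filter]
      rw [Finset.sum_comm]
      simp only [← Finset.card_filter]
      refine (Finset.sum_le_card_nsmul _ _ 4 ?_).trans (by simp)
      intro b hb
      exact hE b hb _ (fun i hi => (Finset.mem_filter.1 hi).2)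
    have h3 : ∑ i : Fin n, 2 ≤ ∑ i : Fin n, ((B.filter fun b => P b i).card +
        (B.filter fun b => ∀ b' ∈ B, b' ≠ b → ¬ P b' i).card) := by
      apply Finset.sum_le_sum
      intro i _
      obtain ⟨b, hb, hbi⟩ := hcov i
      by_cases h : ∀ b' ∈ B, b' ≠ b → ¬ P b' i
      · have h1 : 0 < (B.filter fun b => P b i).card :=
          Finset.card_pos.2 ⟨b, Finset.mem_filter.2 ⟨hb, hbi⟩⟩
        have h2 : 0 < (B.filter fun b => ∀ b' ∈ B, b' ≠ b → ¬ P b' i).card :=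
          Finset.card_pos.2 ⟨b, Finset.mem_filter.2 ⟨hb, h⟩⟩
        omega
      · push Not at h
        obtain ⟨b', hb', hne, hp⟩ := h
        have : 1 < (B.filter fun b => P b i).card :=
          Finset.one_lt_card.2 ⟨b', Finset.mem_filter.2 ⟨hb', hp⟩, b,
            Finset.mem_filter.2 ⟨hb, hbi⟩, hne⟩
        omega
    rw [Finset.sum_add_distrib] at h3
    simp only [Finset.sum_const, Finset.card_univ, Fintype.card_fin, smul_eq_mul] at h3
    nlinarith

lemma aux_params {n k r : ℕ} (hr : 5 ≤ r) (hp : SingletonOptimalParams n k 6 r)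
    (hkmod : (k : ℤ) ≡ 0 [ZMOD (r : ℤ)] ∨ (k : ℤ) ≡ -1 [ZMOD (r : ℤ)] ∨
      (k : ℤ) ≡ -2 [ZMOD (r : ℤ)] ∨ (k : ℤ) ≡ -3 [ZMOD (r : ℤ)]) :
    ∃ m j : ℕ, j ≤ 3 ∧ k + j = m * r ∧ n = k + m + 4 := by
  unfold SingletonOptimalParams at hp
  have h1 : ∃ j : ℕ, j ≤ 3 ∧ (r : ℤ) ∣ ((k + j : ℕ) : ℤ) := by
    rcases hkmod with h | h | h | h
    · exact ⟨0, by omega, by simpa using (Int.modEq_zero_iff_dvd.1 h)⟩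
    · exact ⟨1, by omega, by simpa using h.symm.dvd⟩
    · exact ⟨2, by omega, by simpa using h.symm.dvd⟩
    · exact ⟨3, by omega, by simpa using h.symm.dvd⟩
  obtain ⟨j, hj, hdvd⟩ := h1
  obtain ⟨m, hm⟩ := Int.natCast_dvd_natCast.1 hdvd
  refine ⟨m, j, hj, by rw [hm, mul_comm], ?_⟩
  have hr0 : (0 : ℚ) < r := by exact_mod_cast (by omega : 0 < r)
  have hq : (k : ℚ) + j = r * m := by exact_mod_cast hm
  have hj3 : (j : ℚ) ≤ 3 := by exact_mod_cast hj
  have hr5 : (5 : ℚ) ≤ r := by exact_mod_cast hr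
  have hj0 : (0 : ℚ) ≤ j := by positivity
  have hceil : ⌈(k : ℚ) / (r : ℚ)⌉ = (m : ℤ) := by
    rw [Int.ceil_eq_iff]
    constructor
    · rw [lt_div_iff₀ hr0]; push_cast; nlinarith
    · rw [div_le_iff₀ hr0]; push_cast; nlinarith
  rw [hceil] at hp
  push_cast at hp
  omega

end Aux

/-- Theorem 3.11 (iv): a `q`-ary Singleton-optimal `[n,k,6;r]`-LRC
with `r ≥ 5`, `r < k`, `n ≥ 2(r+1)` and `k ≡ 0, -1, -2` or `-3 (mod r)` satisfies
`n < (r+6)(5r-1)/(r-4)`; in particular `n = O(r)`. -/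
theorem optLRC_d6_large_r {F : Type*} [Field F] [Fintype F] [DecidableEq F]
    {n k r : ℕ} (C : Submodule F (Fin n → F))
    (hC : IsOptLRC C k 6 r) (hr : 5 ≤ r) (hrk : r < k)
    (hn : 2 * (r + 1) ≤ n)
    (hkmod : (k : ℤ) ≡ 0 [ZMOD (r : ℤ)] ∨ (k : ℤ) ≡ -1 [ZMOD (r : ℤ)] ∨
      (k : ℤ) ≡ -2 [ZMOD (r : ℤ)] ∨ (k : ℤ) ≡ -3 [ZMOD (r : ℤ)]) :
    (n : ℚ) < ((r : ℚ) + 6) * (5 * (r : ℚ) - 1) / ((r : ℚ) - 4) := by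
  classical
  obtain ⟨hk, ⟨-, hd⟩, hloc, hp⟩ := hC
  obtain ⟨m, j, hj, hkm, hnk⟩ := aux_params hr hp hkmod
  let S : Set (Module.Dual F (Fin n → F)) := {φ | φ ∈ C.dualAnnihilator ∧
    (univ.filter fun i => φ (Pi.single i 1) ≠ 0).card ≤ r + 1}
  obtain ⟨b, hbS, hspan, hli⟩ := exists_linearIndependent F S
  have hfin : b.Finite := Set.finite_coe_iff.1 hli.finite
  obtain ⟨B, rfl⟩ := hfin.exists_finset_coe
  have hli' : LinearIndepOn F id (B : Set (Module.Dual F (Fin n → F))) := hli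
  have hBdual : ∀ φ ∈ B, φ ∈ C.dualAnnihilator := fun φ h => (hbS h).1
  have hcov : ∀ i, ∃ φ ∈ B, φ (Pi.single i 1) ≠ 0 := by
    intro i
    obtain ⟨R, hRc, hR⟩ := hloc i
    obtain ⟨φ, hφC, hφi, hφR⟩ := aux_recover C i R hR
    have hφS : φ ∈ S := ⟨hφC, (Finset.card_le_card
      (fun j hj => hφR j (Finset.mem_filter.1 hj).2)).trans hRc⟩
    by_contra hno
    push Not at hno
    apply hφi
    have hle : Submodule.span F (B : Set (Module.Dual F (Fin n → F))) ≤
        LinearMap.ker (Module.Dual.eval F (Fin n → F) (Pi.single i 1)) := by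
      rw [Submodule.span_le]
      intro ψ hψ
      exact hno ψ hψ
    have h1 : φ ∈ Submodule.span F (B : Set (Module.Dual F (Fin n → F))) :=
      hspan ▸ Submodule.subset_span hφS
    exact hle h1
  obtain ⟨hc1, hc2⟩ := aux_count_s14 (n := n) (r := r) B (fun φ i => φ (Pi.single i 1) ≠ 0)
    (fun φ h => (hbS h).2) hcov
  have hkm' : n + j = m * (r + 1) + 4 := by rw [mul_add]; omega
  have hlm : m + 1 ≤ B.card := by
    by_contra hlt
    have : B.card * (r + 1) ≤ m * (r + 1) := Nat.mul_le_mul_right _ (by omega)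
    omega
  have hc3 := hc2 (fun φ hφ E hE => aux_excl (l := 0) C hk hd B hBdual hli' (by omega) φ hφ E
    (fun i hi ψ hψ hne => not_not.1 (hE i hi ψ hψ hne)))
  have hcard : B.card ≤ m + 4 := by
    have h1 := Subspace.finrank_add_finrank_dualAnnihilator_eq C
    rw [Module.finrank_fin_fun, hk] at h1
    have h2 : Submodule.span F (B : Set (Module.Dual F (Fin n → F))) ≤ C.dualAnnihilator :=
      Submodule.span_le.2 (fun φ h => hBdual φ h)
    have h3 := Submodule.finrank_mono h2
    rw [finrank_span_finset_eq_card hli'] at h3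
    omega
  have hr5 : (5 : ℚ) ≤ r := by exact_mod_cast hr
  rw [lt_div_iff₀ (by linarith)]
  have h5 : 2 * n ≤ (m + 4) * (r + 5) := hc3.trans (Nat.mul_le_mul_right _ hcard)
  have h5q : 2 * (n : ℚ) ≤ (m + 4) * (r + 5) := by exact_mod_cast h5
  have h6q : (n : ℚ) + j = m * (r + 1) + 4 := by exact_mod_cast hkm'
  have hj3 : (j : ℚ) ≤ 3 := by exact_mod_cast hj
  have hj0 : (0 : ℚ) ≤ j := by positivity
  have hm0 : (0 : ℚ) ≤ m := by positivity
  have h7 : (m : ℚ) * (r - 4) ≤ 4 * r + 18 := by nlinarith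
  have h8 : (m : ℚ) * (r - 4) * (r + 1) ≤ (4 * r + 18) * (r + 1) :=
    mul_le_mul_of_nonneg_right h7 (by linarith)
  have h9 : (n : ℚ) * (r - 4) ≤ (m * (r + 1) + 4) * (r - 4) :=
    mul_le_mul_of_nonneg_right (by linarith) (by linarith)
  nlinarith
end

section
/- Let C be a q-ary Singleton-optimal [n,k,d;r]-locally repairable code with d = 7, r ≥ 6, r < k, n ≥ 2(r+1), and k ≡ 0, −1, −2, −3 or −4 (mod r). Then n < (r+7)(6r−1)/(r−5); in particular n = O(r). -/
open Finset

lemma aux_dual_word {F : Type*} [Field F] [Fintype F] [DecidableEq F] {n r : ℕ}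
    (C : Submodule F (Fin n → F)) (h : HasLocality C r) (i : Fin n) :
    ∃ w : Fin n → F, InDual C w ∧ w i ≠ 0 ∧ (univ.filter fun x => w x ≠ 0).card ≤ r + 1 := by
  obtain ⟨R, hR, hi, hrec⟩ := h i
  let L : Fin n → (C →ₗ[F] F) := fun j => (LinearMap.proj j).comp C.subtype
  have hmem : L i ∈ Submodule.span F (Set.range fun j : (R.erase i : Finset (Fin n)) => L j) := by
    apply mem_span_of_iInf_ker_le_ker
    intro c hc
    rw [Submodule.mem_iInf] at hc
    have := hrec c c.2 0 C.zero_mem (by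
      intro j hj hji
      have := hc ⟨j, by simp [hj, hji]⟩
      simpa [L] using this)
    simpa [L] using this
  rw [Submodule.mem_span_range_iff_exists_fun] at hmem
  obtain ⟨a, ha⟩ := hmem
  let b : Fin n → F := fun j => if hj : j ∈ R.erase i then a ⟨j, hj⟩ else 0
  have hbi : b i = 0 := by simp [b]
  have hb0 : ∀ j, j ∉ R → b j = 0 := by
    intro j hj
    simp [b, hj]
  refine ⟨fun j => (if j = i then 1 else 0) - b j, ?_, by simp [hbi], ?_⟩
  · intro c hc
    have h1 := congrArg (fun f => f ⟨c, hc⟩) ha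
    simp only [LinearMap.sum_apply, LinearMap.smul_apply, smul_eq_mul, L, LinearMap.comp_apply,
      LinearMap.proj_apply, Submodule.subtype_apply] at h1
    have h2 : ∑ j, b j * c j = c i := by
      rw [← h1]
      have h3 : ∑ j ∈ R.erase i, b j * c j = ∑ j, b j * c j := by
        apply Finset.sum_subset (Finset.subset_univ _)
        intro j _ hj
        simp only [b, dif_neg hj, zero_mul]
      rw [← h3, ← Finset.sum_coe_sort (R.erase i)]
      apply Finset.sum_congr rfl
      intro j _
      simp only [b, dif_pos j.2, Subtype.coe_eta]
    simp [sub_mul, Finset.sum_sub_distrib, h2]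
  · refine le_trans (Finset.card_le_card ?_) hR
    intro j hj
    by_contra hjR
    have hji : j ≠ i := by rintro rfl; exact hjR hi
    simp [hji, hb0 j hjR] at hj

lemma aux_dim {F : Type*} [Field F] {n : ℕ} (W : Submodule F (Fin n → F))
    {ι : Type*} [Fintype ι] (w : ι → Fin n → F) (hw : LinearIndependent F w)
    (ho : ∀ j, ∀ c ∈ W, ∑ i, w j i * c i = 0) :
    Fintype.card ι + Module.finrank F W ≤ n := by
  let M : Matrix ι (Fin n) F := Matrix.of w
  have hM : M.rank = Fintype.card ι := LinearIndependent.rank_matrix (M := M) hw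
  have h1 := LinearMap.finrank_range_add_finrank_ker (M.mulVecLin)
  have h2 : W ≤ LinearMap.ker M.mulVecLin := by
    intro c hc
    rw [LinearMap.mem_ker]
    ext j
    simpa [M, Matrix.mulVec, dotProduct] using ho j c hc
  have h3 := Submodule.finrank_mono h2
  have h4 : Module.finrank F (LinearMap.range M.mulVecLin) = Fintype.card ι := hM
  simp only [Module.finrank_fin_fun] at h1
  omega

lemma aux_indep {F : Type*} [Field F] {n : ℕ} {ι : Type*} (w : ι → Fin n → F)
    (p : ι → Fin n) (h1 : ∀ i, w i (p i) ≠ 0) (h2 : ∀ i j, j ≠ i → w j (p i) = 0) :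
    LinearIndependent F w := by
  rw [linearIndependent_iff']
  intro s g hg i hi
  have := congrFun hg (p i)
  rw [Finset.sum_apply, Finset.sum_eq_single i] at this
  · simpa [h1 i] using this
  · intro j _ hj
    simp [h2 i j hj]
  · exact fun h => absurd hi h

/-- Private coordinates: at most five. -/
lemma aux_private {F : Type*} [Field F] [Fintype F] [DecidableEq F] {n k m : ℕ}
    (C : Submodule F (Fin n → F)) (hk : Module.finrank F C = k)
    (hd : ∀ c ∈ C, c ≠ 0 → 7 ≤ hammingNorm c) (hnk : n = k + m + 5)
    {ι : Type*} [Fintype ι] (w : ι → Fin n → F) (hw : LinearIndependent F w)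
    (ho : ∀ j, InDual C (w j)) (hl : m ≤ Fintype.card ι)
    (A : Finset (Fin n)) (hA : ∀ j, ∀ x ∈ A, w j x = 0) : A.card ≤ 5 := by
  by_contra hcon
  obtain ⟨B, hBA, hB⟩ := Finset.exists_subset_card_eq (show 6 ≤ A.card by omega)
  let e : B → Fin n → F := fun b => Pi.single (b : Fin n) 1
  have he : LinearIndependent F e :=
    aux_indep e (fun b => b) (by intro b; simp [e]) (by
      intro i j hij
      have : (i : Fin n) ≠ j := fun h => hij (Subtype.ext h.symm)
      simp [e, this])
  let E : Submodule F (Fin n → F) := Submodule.span F (Set.range e)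
  have hE : Module.finrank F E = 6 := by
    rw [finrank_span_eq_card he]; simp [hB]
  have hEs : ∀ x ∈ E, ∀ j, j ∉ B → x j = 0 := by
    intro x hx j hj
    have : E ≤ LinearMap.ker (LinearMap.proj (R := F) (φ := fun _ : Fin n => F) j) := by
      rw [Submodule.span_le]
      rintro _ ⟨b, rfl⟩
      have : j ≠ b := by rintro rfl; exact hj b.2
      simp [e, this]
    simpa using this hx
  have hinf : C ⊓ E = ⊥ := by
    rw [Submodule.eq_bot_iff]
    rintro x ⟨hxC, hxE⟩
    by_contra hx
    have h7 := hd x hxC hx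
    have : hammingNorm x ≤ B.card := by
      unfold hammingNorm
      apply Finset.card_le_card
      intro j hj
      by_contra hjB
      simp [hEs x hxE j hjB] at hj
    omega
  have hsum := Submodule.finrank_sup_add_finrank_inf_eq C E
  rw [hinf, finrank_bot, hE, hk] at hsum
  have := aux_dim (C ⊔ E) w hw (by
    intro j c hc
    obtain ⟨y, hy, z, hz, rfl⟩ := Submodule.mem_sup.1 hc
    have h1 := ho j y hy
    have h2 : ∑ i, w j i * z i = 0 := by
      apply Finset.sum_eq_zero
      intro i _
      by_cases hi : i ∈ B
      · simp [hA j i (hBA hi)]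
      · simp [hEs z hz i hi]
    simp [mul_add, Finset.sum_add_distrib, h1, h2])
  omega

lemma aux_main {F : Type*} [Field F] [Fintype F] [DecidableEq F] {n k m r : ℕ}
    (C : Submodule F (Fin n → F)) (hk : Module.finrank F C = k)
    (hd : ∀ c ∈ C, c ≠ 0 → 7 ≤ hammingNorm c) (hloc : HasLocality C r)
    (hnk : n = k + m + 5) (hnm : (r + 1) * m < n) :
    2 * n ≤ (m + 5) * (r + 6) := by
  choose w hwd hwi hwc using aux_dual_word C hloc
  obtain ⟨S, hScov, hSmin⟩ := exists_min_image
    (univ.filter fun S : Finset (Fin n) => ∀ x, ∃ i ∈ S, w i x ≠ 0) Finset.card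
    ⟨univ, by simp only [mem_filter, mem_univ, true_and]; exact fun x => ⟨x, hwi x⟩⟩
  simp only [mem_filter, mem_univ, true_and] at hScov hSmin
  have hpriv : ∀ i : S, ∃ p, w i p ≠ 0 ∧ ∀ j ∈ S, j ≠ i → w j p = 0 := by
    intro i
    by_contra! hcon
    have := hSmin (S.erase i) (by
      intro x
      obtain ⟨j, hj, hjx⟩ := hScov x
      by_cases hji : j = i
      · subst hji
        obtain ⟨j', hj', hne, hx⟩ := hcon x hjx
        exact ⟨j', by simp [hj', hne], hx⟩
      · exact ⟨j, by simp [hj, hji], hjx⟩)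
    have := Finset.card_erase_lt_of_mem i.2
    omega
  choose p hp1 hp2 using hpriv
  have hind : LinearIndependent F (fun i : S => w i) :=
    aux_indep _ p hp1 (fun i j hij => hp2 i j j.2 (fun h => hij (Subtype.ext h)))
  have hle := aux_dim C (fun i : S => w i) hind (fun j => hwd j)
  rw [hk, Fintype.card_coe] at hle
  let Sup : Fin n → Finset (Fin n) := fun i => univ.filter fun x => w i x ≠ 0
  let P : Fin n → Finset (Fin n) := fun i =>
    univ.filter fun x => w i x ≠ 0 ∧ ∀ j ∈ S, j ≠ i → w j x = 0
  have hcount : n ≤ S.card * (r + 1) := by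
    have : (univ : Finset (Fin n)) ⊆ S.biUnion Sup := by
      intro x _
      obtain ⟨i, hi, hx⟩ := hScov x
      simp only [mem_biUnion]
      exact ⟨i, hi, by simp [Sup, hx]⟩
    have h1 := Finset.card_le_card this
    have h2 := Finset.card_biUnion_le_card_mul S Sup (r + 1) (fun i _ => hwc i)
    simp at h1
    omega
  have hS : m + 1 ≤ S.card := by
    by_contra h
    have : S.card * (r + 1) ≤ m * (r + 1) := Nat.mul_le_mul_right _ (by omega)
    rw [mul_comm m] at this
    omega
  have hP : ∀ i ∈ S, (P i).card ≤ 5 := by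
    intro i hi
    refine aux_private C hk hd hnk (fun j : (S.erase i : Finset (Fin n)) => w j) ?_
      (fun j => hwd j) ?_ (P i) ?_
    · exact hind.comp (fun j : (S.erase i : Finset (Fin n)) =>
        (⟨j, Finset.mem_of_mem_erase j.2⟩ : S)) (by
          intro a b hab
          exact Subtype.ext (congrArg (fun z : S => (z : Fin n)) hab))
    · rw [Fintype.card_coe, Finset.card_erase_of_mem hi]; omega
    · intro j x hx
      simp only [P, mem_filter] at hx
      exact hx.2.2 j (Finset.mem_of_mem_erase j.2) (Finset.ne_of_mem_erase j.2)
  have key : ∀ x : Fin n, 2 ≤ ∑ i ∈ S, ((if x ∈ Sup i then 1 else 0) + if x ∈ P i then 1 else 0) := by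
    intro x
    obtain ⟨i, hi, hx⟩ := hScov x
    have hxi : x ∈ Sup i := by simp [Sup, hx]
    by_cases hpx : x ∈ P i
    · refine le_trans ?_ (Finset.single_le_sum (fun _ _ => Nat.zero_le _) hi)
      simp [hxi, hpx]
    · have : ∃ j ∈ S, j ≠ i ∧ w j x ≠ 0 := by
        by_contra! hcon
        exact hpx (by simp only [P, mem_filter, mem_univ, true_and]; exact ⟨hx, hcon⟩)
      obtain ⟨j, hj, hji, hjx⟩ := this
      have hxj : x ∈ Sup j := by simp [Sup, hjx]
      have hsub : ({i, j} : Finset (Fin n)) ⊆ S := by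
        intro y hy
        simp only [mem_insert, mem_singleton] at hy
        rcases hy with rfl | rfl <;> assumption
      refine le_trans ?_ (Finset.sum_le_sum_of_subset hsub)
      rw [Finset.sum_pair hji.symm, if_pos hxi, if_pos hxj]
      omega
  have h2 : 2 * n ≤ ∑ i ∈ S, ((Sup i).card + (P i).card) := by
    calc 2 * n = ∑ x : Fin n, 2 := by simp [mul_comm]
      _ ≤ ∑ x : Fin n, ∑ i ∈ S, ((if x ∈ Sup i then 1 else 0) + if x ∈ P i then 1 else 0) :=
        Finset.sum_le_sum fun x _ => key x
      _ = _ := by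
        rw [Finset.sum_comm]
        apply Finset.sum_congr rfl
        intro i _
        rw [Finset.sum_add_distrib]
        simp
  have h3 : ∑ i ∈ S, ((Sup i).card + (P i).card) ≤ S.card * (r + 6) := by
    rw [← smul_eq_mul]
    apply Finset.sum_le_card_nsmul
    intro i hi
    have := hP i hi
    have : (Sup i).card ≤ r + 1 := hwc i
    omega
  have h4 : S.card * (r + 6) ≤ (m + 5) * (r + 6) := Nat.mul_le_mul_right _ (by omega)
  omega

/-- Theorem 3.12 (v): a `q`-ary Singleton-optimal `[n,k,7;r]`-LRC
with `r ≥ 6`, `r < k`, `n ≥ 2(r+1)` and `k ≡ 0, -1, -2, -3` or `-4 (mod r)` satisfies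
`n < (r+7)(6r-1)/(r-5)`; in particular `n = O(r)`. -/
theorem optLRC_d7_large_r {F : Type*} [Field F] [Fintype F] [DecidableEq F]
    {n k r : ℕ} (C : Submodule F (Fin n → F))
    (hC : IsOptLRC C k 7 r) (hr : 6 ≤ r) (hrk : r < k)
    (hn : 2 * (r + 1) ≤ n)
    (hkmod : (k : ℤ) ≡ 0 [ZMOD (r : ℤ)] ∨ (k : ℤ) ≡ -1 [ZMOD (r : ℤ)] ∨
      (k : ℤ) ≡ -2 [ZMOD (r : ℤ)] ∨ (k : ℤ) ≡ -3 [ZMOD (r : ℤ)] ∨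
      (k : ℤ) ≡ -4 [ZMOD (r : ℤ)]) :
    (n : ℚ) < ((r : ℚ) + 7) * (6 * (r : ℚ) - 1) / ((r : ℚ) - 5) := by
  obtain ⟨hk, ⟨_, hd⟩, hloc, hopt⟩ := hC
  have hj : ∃ j : ℤ, 0 ≤ j ∧ j ≤ 4 ∧ (k : ℤ) ≡ -j [ZMOD (r : ℤ)] := by
    rcases hkmod with h | h | h | h | h
    · exact ⟨0, by norm_num, by norm_num, by simpa using h⟩
    · exact ⟨1, by norm_num, by norm_num, h⟩
    · exact ⟨2, by norm_num, by norm_num, h⟩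
    · exact ⟨3, by norm_num, by norm_num, h⟩
    · exact ⟨4, by norm_num, by norm_num, h⟩
  obtain ⟨j, hj0, hj4, hmod⟩ := hj
  obtain ⟨a, ha⟩ := hmod.symm.dvd
  have hrQ : (0 : ℚ) < r := by
    have : 0 < r := by omega
    exact_mod_cast this
  have hka : (k : ℤ) = r * a - j := by linarith
  have hceil : ⌈(k : ℚ) / (r : ℚ)⌉ = a := by
    rw [Int.ceil_eq_iff]
    have hkQ : (k : ℚ) = r * a - j := by exact_mod_cast hka
    have h0 : (0 : ℚ) ≤ j := by exact_mod_cast hj0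
    have h4 : (j : ℚ) < r := by
      have : j < (r : ℤ) := by omega
      exact_mod_cast this
    constructor
    · rw [lt_div_iff₀ hrQ, hkQ]; linarith
    · rw [div_le_iff₀ hrQ, hkQ]; linarith
  unfold SingletonOptimalParams at hopt
  rw [hceil] at hopt
  have ha0 : 0 ≤ a := by
    by_contra h
    have : (r : ℤ) * a ≤ 0 := mul_nonpos_of_nonneg_of_nonpos (by positivity) (by omega)
    omega
  obtain ⟨m, rfl⟩ := Int.eq_ofNat_of_zero_le ha0
  push_cast at hopt
  have hnk : n = k + m + 5 := by omega
  have hnm : (r + 1) * m < n := by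
    have h : ((r : ℤ) + 1) * m < n := by
      have : ((r : ℤ) + 1) * m = r * m + m := by ring
      omega
    exact_mod_cast h
  have hmain := aux_main C hk hd hloc hnk hnm
  have hr6 : (6 : ℚ) ≤ r := by exact_mod_cast hr
  have h1 : ((r : ℚ) + 1) * m + 1 ≤ n := by exact_mod_cast hnm
  have h2 : 2 * (n : ℚ) ≤ (m + 5) * (r + 6) := by exact_mod_cast hmain
  have hn0 : (0 : ℚ) ≤ n := by positivity
  have h3 : (n : ℚ) * (r - 4) ≤ (r + 6) * (5 * r + 4) := by
    have e1 := mul_le_mul_of_nonneg_right h2 (show (0 : ℚ) ≤ r + 1 by linarith)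
    have e2 := mul_le_mul_of_nonneg_right h1 (show (0 : ℚ) ≤ r + 6 by linarith)
    nlinarith
  rw [lt_div_iff₀ (by linarith)]
  nlinarith
end

section
/- Let C be a q-ary Singleton-optimal [n,k,d;r]-locally repairable code with r < k and n ≥ 2(r+1), and let s be the integer with 0 ≤ s ≤ r−1 and k ≡ −s (mod r). If s + 2 < d < r + 2, then n < (d+r)(r−1+(d−2)r)/(r−d+2). -/
open Finset

section Aux

variable {F : Type*} [Field F] [Fintype F] [DecidableEq F]

lemma aux_exists_vanish {n : ℕ} (C : Submodule F (Fin n → F)) (B : Finset (Fin n))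
    (h : B.card < Module.finrank F ↥C) : ∃ c ∈ C, c ≠ 0 ∧ ∀ i ∈ B, c i = 0 := by
  let φ : ↥C →ₗ[F] (B → F) :=
    (LinearMap.funLeft F F (fun b : B => (b : Fin n))).comp C.subtype
  have hlt : Module.finrank F (B → F) < Module.finrank F ↥C := by
    simpa using h
  have hk := LinearMap.ker_ne_bot_of_finrank_lt (f := φ) hlt
  obtain ⟨x, hx, hx0⟩ := (Submodule.ne_bot_iff _).1 hk
  refine ⟨x.1, x.2, fun h0 => hx0 (Subtype.ext h0), fun i hi => ?_⟩
  have := congrFun (LinearMap.mem_ker.1 hx) ⟨i, hi⟩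
  exact this

lemma aux_seq {n r : ℕ} (R : Fin n → Finset (Fin n)) (hR : ∀ i, (R i).card ≤ r + 1)
    (hn : 0 < n) (m : ℕ) : (r + 1) * m < n + (r + 1) →
    ∃ f : ℕ → Fin n, ∀ j < m, ∀ l < j, f j ∉ R (f l) := by
  induction m with
  | zero => intro _; exact ⟨fun _ => ⟨0, hn⟩, by simp⟩
  | succ m ih =>
    intro hm
    have h1 : (r + 1) * m < n := by rw [Nat.mul_succ] at hm; omega
    obtain ⟨f, hf⟩ := ih (by omega)
    have hc : ((Finset.range m).biUnion (fun l => R (f l))).card < n := by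
      calc _ ≤ (Finset.range m).card * (r + 1) := Finset.card_biUnion_le_card_mul _ _ _ (fun l _ => hR _)
        _ < n := by rw [Finset.card_range, mul_comm]; exact h1
    obtain ⟨x, hx⟩ : ∃ x, x ∉ (Finset.range m).biUnion (fun l => R (f l)) := by
      by_contra! hcon
      rw [Finset.eq_univ_iff_forall.2 hcon] at hc
      simp at hc
    refine ⟨fun j => if j = m then x else f j, fun j hj l hl => ?_⟩
    have hlm : l ≠ m := by omega
    by_cases hjm : j = m
    · simp only [hjm, if_true, hlm, if_false]
      intro hxx
      exact hx (Finset.mem_biUnion.2 ⟨l, by simp; omega, hxx⟩)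
    · simp only [hjm, hlm, if_false]
      exact hf j (by omega) l hl

lemma aux_union_s16 {n k d K : ℕ} (C : Submodule F (Fin n → F)) (R : Fin n → Finset (Fin n))
    (hR : ∀ i, IsRecoverySet C i (R i)) (hk : Module.finrank F ↥C = k)
    (hd : ∀ c ∈ C, c ≠ 0 → d ≤ hammingNorm c) (hn : n + 2 = k + K + d) (hd2 : 2 ≤ d)
    (f : ℕ → Fin n) (J : Finset ℕ) (hJ : J.card = K)
    (hf : ∀ j ∈ J, ∀ l < j, f j ∉ R (f l)) :
    k + K ≤ (J.biUnion (fun j => R (f j))).card := by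
  by_contra! hcon
  set U := J.biUnion (fun j => R (f j)) with hU
  set I := J.image f with hI
  have hinj : Set.InjOn f J := by
    intro a ha b hb hab
    by_contra hne
    rcases lt_or_gt_of_ne hne with h | h
    · exact hf b hb a h (hab ▸ (hR (f a)).1)
    · exact hf a ha b h (hab ▸ (hR (f b)).1)
  have hIc : I.card = K := by rw [hI, Finset.card_image_of_injOn hinj, hJ]
  have hIU : I ⊆ U := by
    intro x hx
    obtain ⟨j, hj, rfl⟩ := Finset.mem_image.1 hx
    exact Finset.mem_biUnion.2 ⟨j, hj, (hR _).1⟩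
  have h1 : (U \ I).card ≤ k - 1 := by rw [Finset.card_sdiff_of_subset hIU]; omega
  have h2 : k - 1 ≤ (Finset.univ \ I).card := by
    rw [Finset.card_sdiff_of_subset (Finset.subset_univ _), Finset.card_univ, Fintype.card_fin]; omega
  obtain ⟨B, hB1, hB2, hB3⟩ := Finset.exists_subsuperset_card_eq
    (Finset.sdiff_subset_sdiff (Finset.subset_univ U) (le_refl I)) h1 h2
  have hk0 : 0 < k := by
    have := Finset.card_le_card hIU
    omega
  obtain ⟨c, hc, hc0, hcB⟩ := aux_exists_vanish C B (by omega)
  have hcI : ∀ j, j ∈ J → c (f j) = 0 := by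
    intro j
    induction j using Nat.strong_induction_on with
    | _ j ih =>
      intro hj
      have := (hR (f j)).2 c hc 0 C.zero_mem (fun x hx hxj => ?_)
      · simpa using this
      · by_cases hxI : x ∈ I
        · obtain ⟨l, hl, rfl⟩ := Finset.mem_image.1 hxI
          rcases lt_trichotomy l j with h | h | h
          · simpa using ih l h hl
          · exact absurd (by rw [h]) hxj
          · exact absurd hx (hf l hl j h)
        · simpa using hcB x (hB1 (Finset.mem_sdiff.2 ⟨Finset.mem_biUnion.2 ⟨j, hj, hx⟩, hxI⟩))
  have hw := hd c hc hc0
  have hdis : Disjoint B I := by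
    rw [Finset.disjoint_left]
    intro x hx
    exact (Finset.mem_sdiff.1 (hB2 hx)).2
  have hsub : (Finset.univ.filter fun i => c i ≠ 0) ⊆ Finset.univ \ (B ∪ I) := by
    intro x hx
    simp only [Finset.mem_filter, Finset.mem_univ, true_and] at hx
    simp only [Finset.mem_sdiff, Finset.mem_univ, true_and, Finset.mem_union]
    rintro (h | h)
    · exact hx (hcB x h)
    · obtain ⟨l, hl, rfl⟩ := Finset.mem_image.1 h
      exact hx (hcI l hl)
  have hcard := Finset.card_le_card hsub
  rw [Finset.card_sdiff_of_subset (Finset.subset_univ _), Finset.card_univ, Fintype.card_fin,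
    Finset.card_union_of_disjoint hdis] at hcard
  unfold hammingNorm at hw
  omega

lemma aux_count_s16 {α : Type*} [DecidableEq α] (J : Finset ℕ) (S : ℕ → Finset α) :
    2 * (J.biUnion S).card ≤
      ∑ j ∈ J, ((S j).card + ((J.biUnion S) \ ((J.erase j).biUnion S)).card) := by
  set U := J.biUnion S with hU
  have e1 : ∀ j ∈ J, (S j).card = ∑ x ∈ U, if x ∈ S j then 1 else 0 := by
    intro j hj
    rw [← Finset.card_filter]
    congr 1
    ext x
    simp only [Finset.mem_filter]
    exact ⟨fun h => ⟨Finset.mem_biUnion.2 ⟨j, hj, h⟩, h⟩, fun h => h.2⟩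
  have e2 : ∀ j ∈ J, (U \ ((J.erase j).biUnion S)).card =
      ∑ x ∈ U, if x ∉ (J.erase j).biUnion S then 1 else 0 := by
    intro j hj
    rw [← Finset.card_filter]
    congr 1
    ext x
    simp only [Finset.mem_filter, Finset.mem_sdiff]
  have e3 : ∑ j ∈ J, ((S j).card + (U \ ((J.erase j).biUnion S)).card) =
      ∑ x ∈ U, ∑ j ∈ J, ((if x ∈ S j then 1 else 0) +
        (if x ∉ (J.erase j).biUnion S then 1 else 0)) := by
    rw [Finset.sum_comm]
    refine Finset.sum_congr rfl fun j hj => ?_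
    rw [e1 j hj, e2 j hj, Finset.sum_add_distrib]
  rw [e3, mul_comm, ← smul_eq_mul]
  refine Finset.card_nsmul_le_sum _ _ _ fun x hx => ?_
  obtain ⟨j, hj, hxj⟩ := Finset.mem_biUnion.1 hx
  rw [← Finset.add_sum_erase _ _ hj]
  by_cases h : x ∈ (J.erase j).biUnion S
  · obtain ⟨l, hl, hxl⟩ := Finset.mem_biUnion.1 h
    rw [← Finset.add_sum_erase _ _ hl]
    simp only [hxj, hxl, if_true]
    omega
  · simp only [hxj, h, if_true, not_false_iff]
    omega

lemma aux_arith (r K s e D m : ℤ) (hs : 0 ≤ s) (he : 1 ≤ e) (hD : D = s + e) (hm : 1 ≤ m)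
    (hr : r = D + m) (hK : 2 ≤ K)
    (h : 2 * (r * K - s + K) ≤ (K + 1) * (r + 1 + D)) :
    ((r + 1) * K + e) * m < (D + 2 + r) * (r - 1 + D * r) := by
  have h1 : K * m ≤ r + 3 * D - 3 := by subst hr; nlinarith
  have h2 : (r + 1) * (K * m) ≤ (r + 1) * (r + 3 * D - 3) :=
    mul_le_mul_of_nonneg_left h1 (by omega)
  have h3 : 1 ≤ D * (r - 3) + 2 := by
    by_cases h : 3 ≤ r
    · have := mul_nonneg (show 0 ≤ D by omega) (show 0 ≤ r - 3 by omega)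
      linarith
    · have a : r = 2 := by omega
      have b : D = 1 := by omega
      subst a b
      norm_num
  have h4 : (r + 1) * 1 ≤ (r + 1) * (D * (r - 3) + 2) :=
    mul_le_mul_of_nonneg_left h3 (by omega)
  have h5 : e * m ≤ D * m := mul_le_mul_of_nonneg_right (by omega) (by omega)
  have h6 : m ≤ r - 1 + D * r := by nlinarith
  have h7 : (D + 1) * m ≤ (D + 1) * (r - 1 + D * r) :=
    mul_le_mul_of_nonneg_left h6 (by omega)
  nlinarith

end Aux

/-- Theorem 3.13: for a `q`-ary Singleton-optimal `[n,k,d;r]`-LRC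
with `r < k`, `n ≥ 2(r+1)`, where `k ≡ -s (mod r)` with `0 ≤ s ≤ r-1`: if
`s + 2 < d < r + 2`, then `n < (d+r)(r-1+(d-2)r)/(r-d+2)`. -/
theorem optLRC_general_small_d {F : Type*} [Field F] [Fintype F] [DecidableEq F]
    {n k d r : ℕ} (C : Submodule F (Fin n → F))
    (hC : IsOptLRC C k d r) (hrk : r < k) (hn : 2 * (r + 1) ≤ n)
    (s : ℕ) (hs : s ≤ r - 1) (hks : (k : ℤ) ≡ -(s : ℤ) [ZMOD (r : ℤ)])
    (hsd : s + 2 < d) (hdr : d < r + 2) :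
    (n : ℚ) < ((d : ℚ) + (r : ℚ)) * ((r : ℚ) - 1 + ((d : ℚ) - 2) * (r : ℚ)) /
      ((r : ℚ) - (d : ℚ) + 2) := by
  obtain ⟨hfin, ⟨_, hd⟩, hloc, hopt⟩ := hC
  have hr : 2 ≤ r := by omega
  -- the number K
  obtain ⟨K', hK'⟩ : (r : ℤ) ∣ (k : ℤ) + s := by
    have := hks.symm.dvd
    simpa using this
  have hKpos : 2 ≤ K' := by
    by_contra! hlt
    have : (r : ℤ) * K' ≤ r * 1 := mul_le_mul_of_nonneg_left (by omega) (by omega)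
    omega
  lift K' to ℕ using (by omega) with K hKK
  have hceil : ⌈(k : ℚ) / (r : ℚ)⌉ = (K : ℤ) := by
    have hrq : (0 : ℚ) < r := by exact_mod_cast (by omega : 0 < r)
    have hq : (k : ℚ) + s = r * K := by exact_mod_cast hK'
    have hsq : (s : ℚ) < r := by exact_mod_cast (by omega : s < r)
    have hs0 : (0 : ℚ) ≤ s := by positivity
    rw [Int.ceil_eq_iff]
    push_cast
    constructor
    · rw [lt_div_iff₀ hrq]; nlinarith
    · rw [div_le_iff₀ hrq]; nlinarith
  unfold SingletonOptimalParams at hopt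
  rw [hceil] at hopt
  have hnn : n + 2 = k + K + d := by omega
  choose R hRc hR using hloc
  have hKn : (r + 1) * K < n := by
    have : k + s = r * K := by exact_mod_cast hK'
    rw [Nat.add_mul]; omega
  obtain ⟨f, hf⟩ := aux_seq R hRc (by omega) (K + 1) (by rw [Nat.mul_succ]; omega)
  set J := Finset.range (K + 1) with hJ
  set S : ℕ → Finset (Fin n) := fun j => R (f j) with hS
  have hE : ∀ j ∈ J, k + K ≤ ((J.erase j).biUnion S).card := by
    intro j hj
    refine aux_union_s16 C R hR hfin hd hnn (by omega) f (J.erase j) ?_ ?_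
    · rw [Finset.card_erase_of_mem hj, hJ, Finset.card_range]; omega
    · intro i hi l hl
      exact hf i (Finset.mem_range.1 (Finset.mem_of_mem_erase hi)) l hl
  have hcount := aux_count_s16 J S
  have hUn : (J.biUnion S).card ≤ n := by
    simpa using Finset.card_le_univ (J.biUnion S)
  have hsum : ∑ j ∈ J, ((S j).card + ((J.biUnion S) \ ((J.erase j).biUnion S)).card)
      ≤ J.card • (r + 1 + (d - 2)) := by
    refine Finset.sum_le_card_nsmul _ _ _ fun j hj => ?_
    have h1 := hRc (f j)
    have h2 := hE j hj
    have h3 : (S j).card ≤ r + 1 := h1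
    rw [Finset.card_sdiff_of_subset
      (Finset.biUnion_subset_biUnion_of_subset_left _ (Finset.erase_subset _ _))]
    omega
  have hUk : k + K ≤ (J.biUnion S).card := by
    refine (hE 0 (by simp [hJ])).trans (Finset.card_le_card ?_)
    exact Finset.biUnion_subset_biUnion_of_subset_left _ (Finset.erase_subset _ _)
  have hmain : 2 * (k + K) ≤ (K + 1) * (r + 1 + (d - 2)) := by
    have : J.card = K + 1 := by simp [hJ]
    rw [this, smul_eq_mul] at hsum
    omega
  have hmainZ : 2 * ((r : ℤ) * K - s + K) ≤ ((K : ℤ) + 1) * (r + 1 + (d - 2)) := by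
    have h2 : ((d - 2 : ℕ) : ℤ) = (d : ℤ) - 2 := by omega
    have := (Nat.cast_le (α := ℤ)).2 hmain
    push_cast [h2] at this
    rw [← hK']
    linarith
  have hfinal := aux_arith r K s ((d : ℤ) - 2 - s) ((d : ℤ) - 2) ((r : ℤ) - d + 2)
    (by omega) (by omega) (by ring) (by omega) (by ring) (by omega) hmainZ
  have hnz : (n : ℤ) = (r + 1) * K + ((d : ℤ) - 2 - s) := by
    rw [add_mul, ← hK']; omega
  rw [← hnz] at hfinal
  have hmq : (0 : ℚ) < (r : ℚ) - d + 2 := by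
    have : (0 : ℤ) < (r : ℤ) - d + 2 := by omega
    exact_mod_cast this
  rw [lt_div_iff₀ hmq]
  have hq := (Int.cast_lt (R := ℚ)).2 hfinal
  push_cast at hq
  linarith
end

section
/- Let C be a q-ary Singleton-optimal [n,k,d;r]-locally repairable code with disjoint recovery sets, such that at least one block of the associated partition of {1,…,n} has size exactly r+1. Let a be an integer with 0 ≤ a ≤ r+1 such that ⌈k/r⌉ = ⌈(k−a)/r⌉, and assume k − a ≥ 1 and d ≥ r + 2. Then there exists a q-ary Singleton-optimal [n−(r+1), k−a, d−(r+1)+a; r]-locally repairable code with disjoint recovery sets. -/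
open Finset

theorem aux_shorten {F : Type*} [Field F] {n : ℕ} (C : Submodule F (Fin n → F))
    (A : Finset (Fin n)) (m : ℕ) (hm : m + A.card ≤ Module.finrank F C) :
    ∃ D : Submodule F (Fin n → F), D ≤ C ∧ Module.finrank F D = m ∧
      ∀ c ∈ D, ∀ i ∈ A, c i = 0 := by
  let φ : C →ₗ[F] (A → F) :=
    (LinearMap.funLeft F F (fun i : A => (i : Fin n))).comp C.subtype
  have h1 := φ.finrank_range_add_finrank_ker
  have h2 : Module.finrank F (LinearMap.range φ) ≤ A.card := by
    refine (Submodule.finrank_le _).trans ?_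
    simp
  have h3 : Module.finrank F (Fin m → F) ≤ Module.finrank F (LinearMap.ker φ) := by
    simp; omega
  rw [← Submodule.finrank_map_subtype_eq C (LinearMap.ker φ)] at h3
  obtain ⟨g, hg⟩ := finrank_le_iff_exists_linearMap.mp h3
  let G : (Fin m → F) →ₗ[F] (Fin n → F) := ((LinearMap.ker φ).map C.subtype).subtype.comp g
  have hG : Function.Injective G := by
    intro x y h
    exact hg (Subtype.ext h)
  refine ⟨LinearMap.range G, ?_, ?_, ?_⟩
  · rintro _ ⟨x, rfl⟩
    obtain ⟨y, hy, hyx⟩ := (g x).2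
    change (g x : Fin n → F) ∈ C
    rw [← hyx]
    exact y.2
  · rw [LinearMap.finrank_range_of_inj hG]; simp
  · rintro _ ⟨x, rfl⟩ i hi
    obtain ⟨y, hy, hyx⟩ := (g x).2
    have := hy
    replace this := LinearMap.mem_ker.mp this
    exact (congrFun hyx i).symm.trans (congrFun this ⟨i, hi⟩)

theorem aux_exists_ne {F : Type*} [Field F] {n : ℕ} (C : Submodule F (Fin n → F))
    (A : Finset (Fin n)) (hA : A.card < Module.finrank F C) :
    ∃ c ∈ C, c ≠ 0 ∧ ∀ i ∈ A, c i = 0 := by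
  obtain ⟨D, hD, hr, hz⟩ := aux_shorten C A 1 (by omega)
  have : D ≠ ⊥ := by
    rintro rfl
    simp at hr
  obtain ⟨c, hc, h0⟩ := (Submodule.ne_bot_iff _).mp this
  exact ⟨c, hD hc, h0, hz c hc⟩

theorem aux_recover_s18 {F : Type*} [Field F] [Fintype F] [DecidableEq F] {n r : ℕ}
    {C : Submodule F (Fin n → F)}
    {P : Finset (Finset (Fin n))} (hP : IsRecoveryPartition C r P)
    {S : Finset (Fin n)} (hS : S ∈ P) {i : Fin n} (hi : i ∈ S) {c : Fin n → F} (hc : c ∈ C)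
    (h : ∀ j ∈ S, j ≠ i → c j = 0) : c i = 0 := by
  obtain ⟨x, hx, -, -, rfl⟩ := hP.1 S hS
  have h1 := hx c hc
  rw [Finset.sum_eq_single i] at h1
  · simp at hi
    simpa [hi] using h1
  · intro j _ hj
    by_cases h0 : x j = 0
    · simp [h0]
    · simp [h j (by simpa using h0) hj]
  · simp

theorem aux_card {F : Type*} [Field F] [Fintype F] [DecidableEq F] {n r : ℕ}
    {C : Submodule F (Fin n → F)}
    {P : Finset (Finset (Fin n))} (hP : IsRecoveryPartition C r P)
    {S : Finset (Fin n)} (hS : S ∈ P) : S.card ≤ r + 1 ∧ S.Nonempty := by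
  obtain ⟨x, hx, h0, hw, rfl⟩ := hP.1 S hS
  refine ⟨hw, ?_⟩
  obtain ⟨i, hi⟩ := Function.ne_iff.mp h0
  exact ⟨i, by simpa using hi⟩

theorem aux_locality {F : Type*} [Field F] [Fintype F] [DecidableEq F] {n r : ℕ}
    {C : Submodule F (Fin n → F)}
    {P : Finset (Finset (Fin n))} (hP : IsRecoveryPartition C r P) : HasLocality C r := by
  intro i
  obtain ⟨S, hS, hi⟩ := hP.2.2 i
  refine ⟨S, (aux_card hP hS).1, hi, fun u hu v hv h => ?_⟩
  have := aux_recover_s18 hP hS hi (C.sub_mem hu hv) (fun j hj hji => by simp [h j hj hji])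
  simpa [sub_eq_zero] using this

/-- Singleton-type bound for disjoint recovery sets. -/
theorem aux_singleton {F : Type*} [Field F] [Fintype F] [DecidableEq F] {n r : ℕ}
    {C : Submodule F (Fin n → F)}
    {P : Finset (Finset (Fin n))} (hP : IsRecoveryPartition C r P) (m : ℕ)
    (hm : m * r < Module.finrank F C) :
    ∃ c ∈ C, c ≠ 0 ∧ hammingNorm c + (Module.finrank F C - 1) + m ≤ n := by
  have hne : ∀ S : P, (S : Finset (Fin n)).Nonempty := fun S => (aux_card hP S.2).2
  choose rep hrep using hne
  have hinj : Function.Injective rep := by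
    intro S T h
    by_contra hST
    have hd := hP.2.1 S S.2 T T.2 (fun h => hST (Subtype.ext h))
    exact Finset.disjoint_left.mp hd (hrep S) (h ▸ hrep T)
  -- membership of a representative in a block
  have hmem : ∀ S T : P, rep T ∈ (S : Finset (Fin n)) → T = S := by
    intro S T h
    by_contra hST
    have hd := hP.2.1 T T.2 S S.2 (fun h => hST (Subtype.ext h))
    exact Finset.disjoint_left.mp hd (hrep T) h
  -- vanishing
  have hvan : ∀ (Q : Finset P) (A : Finset (Fin n)) (c : Fin n → F), c ∈ C →
      (∀ i ∈ A, c i = 0) → (Q.biUnion (fun S => (S : Finset (Fin n)))) \ Q.image rep ⊆ A →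
      ∀ i ∈ Q.image rep, c i = 0 := by
    intro Q A c hc hA hQ i hi
    obtain ⟨S, hS, rfl⟩ := Finset.mem_image.mp hi
    refine aux_recover_s18 hP S.2 (hrep S) hc (fun j hj hji => hA j (hQ ?_))
    rw [Finset.mem_sdiff, Finset.mem_biUnion]
    refine ⟨⟨S, hS, hj⟩, fun h => ?_⟩
    obtain ⟨T, hT, rfl⟩ := Finset.mem_image.mp h
    exact hji (by rw [hmem S T hj])
  have hcimg : ∀ Q : Finset P, (Q.image rep).card = Q.card :=
    fun Q => Finset.card_image_of_injective _ hinj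
  have hsub : ∀ Q : Finset P, Q.image rep ⊆ Q.biUnion (fun S => (S : Finset (Fin n))) := by
    intro Q i hi
    obtain ⟨S, hS, rfl⟩ := Finset.mem_image.mp hi
    exact Finset.mem_biUnion.mpr ⟨S, hS, hrep S⟩
  have hub : ∀ Q : Finset P, (Q.biUnion (fun S => (S : Finset (Fin n)))).card
      ≤ Q.card * (r + 1) :=
    fun Q => Finset.card_biUnion_le_card_mul _ _ _ (fun S _ => (aux_card hP S.2).1)
  have hsd : ∀ Q : Finset P, ((Q.biUnion (fun S => (S : Finset (Fin n)))) \ Q.image rep).card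
      ≤ Q.card * r := by
    intro Q
    rw [Finset.card_sdiff_of_subset (hsub Q), hcimg]
    have := hub Q
    rw [mul_add, mul_one] at this
    omega
  -- dimension is at most the number of coordinates minus the number of blocks
  have hall : (Finset.univ : Finset P).biUnion (fun S => (S : Finset (Fin n))) = Finset.univ := by
    ext i
    obtain ⟨S, hS, hi⟩ := hP.2.2 i
    simp only [Finset.mem_biUnion, Finset.mem_univ, true_and, iff_true]
    exact ⟨⟨S, hS⟩, hi⟩
  have hk : Module.finrank F C ≤
      ((Finset.univ : Finset (Fin n)) \ (Finset.univ : Finset P).image rep).card := by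
    by_contra! hlt
    obtain ⟨c, hc, h0, hz⟩ := aux_exists_ne C _ hlt
    apply h0
    funext i
    by_cases hi : i ∈ (Finset.univ : Finset P).image rep
    · exact hvan Finset.univ _ c hc hz (by rw [hall]) i hi
    · exact hz i (by simpa using hi)
  have hk2 := hsd Finset.univ
  rw [hall] at hk2
  have hmb : m < (Finset.univ : Finset P).card :=
    lt_of_mul_lt_mul_right (hm.trans_le (hk.trans hk2)) (Nat.zero_le r)
  rw [Finset.card_sdiff_of_subset (Finset.subset_univ _), hcimg, Finset.card_univ,
    Fintype.card_fin] at hk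
  obtain ⟨Q, -, hQ⟩ := Finset.exists_subset_card_eq hmb.le
  obtain ⟨A, hA1, hA2, hAc⟩ := Finset.exists_subsuperset_card_eq (n := Module.finrank F C - 1)
    (Finset.sdiff_subset_sdiff (Finset.subset_univ
      (Q.biUnion (fun S => (S : Finset (Fin n))))) (Finset.Subset.refl (Q.image rep)))
    (by have := hsd Q; rw [hQ] at this; omega)
    (by
      rw [Finset.card_sdiff_of_subset (Finset.subset_univ _), hcimg, Finset.card_univ,
        Fintype.card_fin, hQ]
      omega)
  obtain ⟨c, hc, h0, hz⟩ := aux_exists_ne C A (by omega)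
  refine ⟨c, hc, h0, ?_⟩
  have hz2 := hvan Q A c hc hz hA1
  have hdis : Disjoint A (Q.image rep) := by
    rw [Finset.disjoint_left]
    intro i hi
    exact (Finset.mem_sdiff.mp (hA2 hi)).2
  have hdis2 : Disjoint (Finset.univ.filter fun i => c i ≠ 0) (A ∪ Q.image rep) := by
    rw [Finset.disjoint_left]
    intro i hi h
    rcases Finset.mem_union.mp h with h | h
    · exact (Finset.mem_filter.mp hi).2 (hz i h)
    · exact (Finset.mem_filter.mp hi).2 (hz2 i h)
  have := Finset.card_le_univ ((Finset.univ.filter fun i => c i ≠ 0) ∪ (A ∪ Q.image rep))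
  rw [Finset.card_union_of_disjoint hdis2, Finset.card_union_of_disjoint hdis, hAc, hcimg, hQ,
    Fintype.card_fin] at this
  have h : hammingNorm c = (Finset.univ.filter fun i => c i ≠ 0).card := rfl
  omega

/-- Lemma 4.2, propagation rule: from a `q`-ary Singleton-optimal
`[n,k,d;r]`-LRC with disjoint recovery sets, at least one block of the partition of size
exactly `r+1`, `d ≥ r+2`, and an integer `0 ≤ a ≤ r+1` with `⌈k/r⌉ = ⌈(k-a)/r⌉` and
`k - a ≥ 1`, one obtains a `q`-ary Singleton-optimal
`[n-(r+1), k-a, d-(r+1)+a; r]`-LRC with disjoint recovery sets. -/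
theorem optLRC_propagation {F : Type*} [Field F] [Fintype F] [DecidableEq F]
    {n k d r a : ℕ} (C : Submodule F (Fin n → F))
    (hC : IsOptLRC C k d r)
    (P : Finset (Finset (Fin n))) (hP : IsRecoveryPartition C r P)
    (hblock : ∃ S ∈ P, S.card = r + 1)
    (ha : a ≤ r + 1)
    (hceil : ⌈(k : ℚ) / (r : ℚ)⌉ = ⌈((k - a : ℕ) : ℚ) / (r : ℚ)⌉)
    (hka : 1 ≤ k - a)
    (hd : r + 2 ≤ d) :
    ∃ C' : Submodule F (Fin (n - (r + 1)) → F),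
      IsOptLRC C' (k - a) (d - (r + 1) + a) r ∧
      HasDisjointRecoverySets C' r := by
  obtain ⟨hk, hdist, -, hopt⟩ := hC
  obtain ⟨S, hS, hScard⟩ := hblock
  obtain ⟨T, hTS, hT⟩ := Finset.exists_subset_card_eq (hScard.symm ▸ ha : a ≤ S.card)
  obtain ⟨D, hDC, hDk, hDz⟩ := aux_shorten C T (k - a) (by omega)
  have hcompl : Sᶜ.card = n - (r + 1) := by
    rw [Finset.card_compl, hScard, Fintype.card_fin]
  let f : Fin (n - (r + 1)) ↪ Fin n := (Sᶜ.orderEmbOfFin hcompl).toEmbedding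
  have hfS : ∀ j, f j ∉ S := fun j =>
    Finset.mem_compl.mp (Finset.orderEmbOfFin_mem Sᶜ hcompl j)
  have hfsurj : ∀ i, i ∉ S → ∃ j, f j = i := by
    intro i hi
    have := Finset.range_orderEmbOfFin Sᶜ hcompl
    have h2 : i ∈ Set.range (Sᶜ.orderEmbOfFin hcompl) := by rw [this]; simpa using hi
    exact h2
  have hrn : r + 1 ≤ n := by
    have := Finset.card_le_univ S
    rwa [hScard, Fintype.card_fin] at this
  -- weights
  have hw : ∀ x ∈ D, x ≠ 0 → d - (r + 1) + a ≤ hammingNorm (x ∘ f) := by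
    intro x hx h0
    have h1 := hdist.2 x (hDC hx) h0
    have h2 : (Finset.univ.filter fun i => x i ≠ 0) ⊆
        (Finset.univ.filter fun j => (x ∘ f) j ≠ 0).map f ∪ (S \ T) := by
      intro i hi
      have hi' := (Finset.mem_filter.mp hi).2
      by_cases hiS : i ∈ S
      · exact Finset.mem_union_right _ (Finset.mem_sdiff.mpr ⟨hiS, fun h => hi' (hDz x hx i h)⟩)
      · obtain ⟨j, rfl⟩ := hfsurj i hiS
        exact Finset.mem_union_left _ (Finset.mem_map_of_mem _ (by simpa using hi'))
    have h3 := (Finset.card_le_card h2).trans (Finset.card_union_le _ _)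
    rw [Finset.card_map, Finset.card_sdiff_of_subset hTS, hScard, hT] at h3
    have h4 : hammingNorm x = (Finset.univ.filter fun i => x i ≠ 0).card := rfl
    have h5 : hammingNorm (x ∘ f) = (Finset.univ.filter fun j => (x ∘ f) j ≠ 0).card := rfl
    omega
  let G : D →ₗ[F] (Fin (n - (r + 1)) → F) := (LinearMap.funLeft F F f).comp D.subtype
  have hG : ∀ x : D, G x = (x : Fin n → F) ∘ f := fun x => rfl
  have hGinj : Function.Injective G := by
    rw [injective_iff_map_eq_zero]
    intro x hx
    by_contra h0
    have := hw x x.2 (fun h => h0 (Subtype.ext h))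
    rw [← hG, hx, hammingNorm_zero] at this
    omega
  have hfr : Module.finrank F (LinearMap.range G) = k - a := by
    rw [LinearMap.finrank_range_of_inj hGinj, hDk]
  have hP' : IsRecoveryPartition (LinearMap.range G) r
      ((P.erase S).image fun B => Finset.univ.filter fun j => f j ∈ B) := by
    refine ⟨?_, ?_, ?_⟩
    · intro B' hB'
      obtain ⟨B, hB, rfl⟩ := Finset.mem_image.mp hB'
      obtain ⟨hBS, hBP⟩ := Finset.mem_erase.mp hB
      have hdj := hP.2.1 B hBP S hS hBS
      obtain ⟨x, hx, h0, hxw, hxB⟩ := hP.1 B hBP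
      have hxB' : ∀ i, i ∈ B ↔ x i ≠ 0 := by intro i; rw [← hxB]; simp
      have hxS : ∀ i ∈ S, x i = 0 := by
        intro i hi
        by_contra h
        exact Finset.disjoint_left.mp hdj ((hxB' i).mpr h) hi
      refine ⟨x ∘ f, ?_, ?_, ?_, ?_⟩
      · rintro _ ⟨c, rfl⟩
        have h1 := hx c (hDC c.2)
        rw [hG]
        rw [← h1]
        refine Finset.sum_of_injOn f f.injective.injOn (by simp) ?_ (by simp)
        intro i _ hi
        rw [hxS i, zero_mul]
        by_contra h
        obtain ⟨j, rfl⟩ := hfsurj i h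
        exact hi ⟨j, by simp, rfl⟩
      · intro h
        apply h0
        funext i
        by_cases hi : i ∈ S
        · exact hxS i hi
        · obtain ⟨j, rfl⟩ := hfsurj i hi
          exact congrFun h j
      · refine le_trans ?_ hxw
        have h4 : hammingNorm x = (Finset.univ.filter fun i => x i ≠ 0).card := rfl
        have h5 : hammingNorm (x ∘ f) = (Finset.univ.filter fun j => (x ∘ f) j ≠ 0).card := rfl
        rw [h4, h5, ← Finset.card_map f]
        apply Finset.card_le_card
        intro i hi
        obtain ⟨j, hj, rfl⟩ := Finset.mem_map.mp hi
        simpa using hj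
      · ext j
        simp [hxB']
    · intro B' hB' E' hE' hne
      obtain ⟨B, hB, rfl⟩ := Finset.mem_image.mp hB'
      obtain ⟨E, hE, rfl⟩ := Finset.mem_image.mp hE'
      have hBE : B ≠ E := by rintro rfl; exact hne rfl
      have := hP.2.1 B (Finset.mem_of_mem_erase hB) E (Finset.mem_of_mem_erase hE) hBE
      rw [Finset.disjoint_left]
      intro j h1 h2
      exact Finset.disjoint_left.mp this (Finset.mem_filter.mp h1).2 (Finset.mem_filter.mp h2).2
    · intro j
      obtain ⟨B, hB, hj⟩ := hP.2.2 (f j)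
      refine ⟨_, Finset.mem_image_of_mem _ (Finset.mem_erase.mpr ⟨?_, hB⟩), by simpa using hj⟩
      rintro rfl
      exact hfS j hj
  have hopt' : SingletonOptimalParams (n - (r + 1)) (k - a) (d - (r + 1) + a) r := by
    unfold SingletonOptimalParams at hopt ⊢
    rw [← hceil]
    omega
  have hmin : ∀ c ∈ LinearMap.range G, c ≠ 0 → d - (r + 1) + a ≤ hammingNorm c := by
    rintro _ ⟨x, rfl⟩ h0
    exact hw x x.2 (fun h => h0 (by rw [show x = 0 from Subtype.ext h, map_zero]))
  refine ⟨LinearMap.range G, ⟨hfr, ⟨?_, hmin⟩, aux_locality hP', hopt'⟩, _, hP'⟩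
  -- the Singleton-type bound
  have hmr : (⌈((k - a : ℕ) : ℚ) / (r : ℚ)⌉ - 1).toNat * r < k - a := by
    rcases Nat.eq_zero_or_pos r with rfl | hr
    · rw [Nat.mul_zero]; exact hka
    · have hr' : (0 : ℚ) < r := by exact_mod_cast hr
      have h1 := Int.ceil_lt_add_one (((k - a : ℕ) : ℚ) / (r : ℚ))
      have hpos : 0 < ⌈((k - a : ℕ) : ℚ) / (r : ℚ)⌉ := by
        apply Int.ceil_pos.mpr
        have : (0 : ℚ) < ((k - a : ℕ) : ℚ) := by exact_mod_cast hka
        positivity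
      generalize ⌈((k - a : ℕ) : ℚ) / (r : ℚ)⌉ = z at h1 hpos
      obtain ⟨m, rfl⟩ : ∃ m : ℕ, z = m + 1 := ⟨(z - 1).toNat, by omega⟩
      have h2 : (m : ℚ) < ((k - a : ℕ) : ℚ) / (r : ℚ) := by push_cast at h1 ⊢; linarith
      rw [lt_div_iff₀ hr'] at h2
      simpa using (by exact_mod_cast h2 : m * r < k - a)
  obtain ⟨c, hc, h0, hcw⟩ := aux_singleton hP' _ (by rw [hfr]; exact hmr)
  refine ⟨c, hc, h0, le_antisymm ?_ (hmin c hc h0)⟩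
  rw [hfr] at hcw
  unfold SingletonOptimalParams at hopt'
  omega
end
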